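/- Let T_C denote the cyclic triangle (the directed 3-cycle). Then n^{-8/15} is the threshold probability for the unbiased T_C-tournament game on the random graph G_{n,p}: if p = p(n) satisfies p(n)·n^{8/15} → ∞ as n → ∞, then asymptotically almost surely Maker has a winning strategy in the unbiased T_C-tournament game on G_{n,p}, and if p(n)·n^{8/15} → 0, then asymptotically almost surely Breaker has a winning strategy. -/

import Mathlib

namespace TournamentGame

variable {V : Type*} [DecidableEq V]

/-- The underlying undirected edges of a set of oriented edges. -/
def undirect (M : Finset (V × V)) : Finset (Sym2 V) :=
  M.image fun p => s(p.1, p.2)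

/-- `MakerWin X F b M B` : in the (1:b) Maker-Breaker game on board `X`, with Maker
having claimed `M`, Breaker having claimed `B`, and Maker to move, Maker has a strategy
to claim all edges of some winning set (i.e. reach a position with `F` on her edges). -/
inductive MakerWin (X : Finset (Sym2 V)) (F : Finset (Sym2 V) → Prop) (b : ℕ) :
    Finset (Sym2 V) → Finset (Sym2 V) → Prop
  | win (M B : Finset (Sym2 V)) : F M → MakerWin X F b M B
  | move (M B : Finset (Sym2 V)) (e : Sym2 V) (heX : e ∈ X) (hefree : e ∉ M ∪ B)
      (h : ∀ B' : Finset (Sym2 V), B' ⊆ X \ (insert e M ∪ B) →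
        B'.card = min b (X \ (insert e M ∪ B)).card →
        MakerWin X F b (insert e M) (B ∪ B')) :
      MakerWin X F b M B

/-- `BreakerBlock X F b M B` : Maker to move; Breaker has a strategy ensuring that `F`
never holds on Maker's edge set. -/
inductive BreakerBlock (X : Finset (Sym2 V)) (F : Finset (Sym2 V) → Prop) (b : ℕ) :
    Finset (Sym2 V) → Finset (Sym2 V) → Prop
  | step (M B : Finset (Sym2 V)) (hF : ¬ F M) (resp : Sym2 V → Finset (Sym2 V))
      (hsub : ∀ e ∈ X, e ∉ M ∪ B → resp e ⊆ X \ (insert e M ∪ B))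
      (hcard : ∀ e ∈ X, e ∉ M ∪ B → (resp e).card = min b (X \ (insert e M ∪ B)).card)
      (h : ∀ e ∈ X, e ∉ M ∪ B → BreakerBlock X F b (insert e M) (B ∪ resp e)) :
      BreakerBlock X F b M B

/-- Oriented (tournament-game) version of `MakerWin`: Maker claims an edge together with
an orientation; her position is a set of oriented edges. -/
inductive OMakerWin (X : Finset (Sym2 V)) (F : Finset (V × V) → Prop) (b : ℕ) :
    Finset (V × V) → Finset (Sym2 V) → Prop
  | win (M : Finset (V × V)) (B : Finset (Sym2 V)) : F M → OMakerWin X F b M B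
  | move (M : Finset (V × V)) (B : Finset (Sym2 V)) (x y : V)
      (heX : s(x, y) ∈ X) (hefree : s(x, y) ∉ undirect M ∪ B)
      (h : ∀ B' : Finset (Sym2 V), B' ⊆ X \ (insert s(x, y) (undirect M) ∪ B) →
        B'.card = min b (X \ (insert s(x, y) (undirect M) ∪ B)).card →
        OMakerWin X F b (insert (x, y) M) (B ∪ B')) :
      OMakerWin X F b M B

/-- Oriented version of `BreakerBlock`. -/
inductive OBreakerBlock (X : Finset (Sym2 V)) (F : Finset (V × V) → Prop) (b : ℕ) :
    Finset (V × V) → Finset (Sym2 V) → Prop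
  | step (M : Finset (V × V)) (B : Finset (Sym2 V)) (hF : ¬ F M)
      (resp : V → V → Finset (Sym2 V))
      (hsub : ∀ x y : V, s(x, y) ∈ X → s(x, y) ∉ undirect M ∪ B →
        resp x y ⊆ X \ (insert s(x, y) (undirect M) ∪ B))
      (hcard : ∀ x y : V, s(x, y) ∈ X → s(x, y) ∉ undirect M ∪ B →
        (resp x y).card = min b (X \ (insert s(x, y) (undirect M) ∪ B)).card)
      (h : ∀ x y : V, s(x, y) ∈ X → s(x, y) ∉ undirect M ∪ B →
        OBreakerBlock X F b (insert (x, y) M) (B ∪ resp x y)) :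
      OBreakerBlock X F b M B

/-- Position with Breaker to move, in the unoriented game: Breaker can respond and
then keep blocking forever. -/
def BreakerTurn (X : Finset (Sym2 V)) (F : Finset (Sym2 V) → Prop) (b : ℕ)
    (M B : Finset (Sym2 V)) : Prop :=
  ¬ F M ∧ ∃ B' : Finset (Sym2 V), B' ⊆ X \ (M ∪ B) ∧
    B'.card = min b (X \ (M ∪ B)).card ∧ BreakerBlock X F b M (B ∪ B')

/-- Position with Breaker to move, in the oriented game. -/
def OBreakerTurn (X : Finset (Sym2 V)) (F : Finset (V × V) → Prop) (b : ℕ)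
    (M : Finset (V × V)) (B : Finset (Sym2 V)) : Prop :=
  ¬ F M ∧ ∃ B' : Finset (Sym2 V), B' ⊆ X \ (undirect M ∪ B) ∧
    B'.card = min b (X \ (undirect M ∪ B)).card ∧ OBreakerBlock X F b M (B ∪ B')

/-- Winning sets of the triangle game. -/
def HasTriangle (M : Finset (Sym2 V)) : Prop :=
  ∃ x y z : V, x ≠ y ∧ y ≠ z ∧ x ≠ z ∧ s(x, y) ∈ M ∧ s(y, z) ∈ M ∧ s(x, z) ∈ M

/-- Maker's oriented edges contain a cyclic (directed) triangle. -/
def HasCyclicTriangle (M : Finset (V × V)) : Prop :=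
  ∃ x y z : V, x ≠ y ∧ y ≠ z ∧ x ≠ z ∧ (x, y) ∈ M ∧ (y, z) ∈ M ∧ (z, x) ∈ M

/-- Maker's oriented edges contain an acyclic (transitive) triangle. -/
def HasAcyclicTriangle (M : Finset (V × V)) : Prop :=
  ∃ x y z : V, x ≠ y ∧ y ≠ z ∧ x ≠ z ∧ (x, y) ∈ M ∧ (y, z) ∈ M ∧ (x, z) ∈ M

/-- A tournament on `Fin k`, given by its arc relation. -/
def IsTournament {k : ℕ} (T : Fin k → Fin k → Prop) : Prop :=
  (∀ i, ¬ T i i) ∧ ∀ i j : Fin k, i ≠ j → (T i j ↔ ¬ T j i)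

/-- Maker's oriented edges contain a copy of the tournament `T`. -/
def HasTCopy {k : ℕ} (T : Fin k → Fin k → Prop) (M : Finset (V × V)) : Prop :=
  ∃ f : Fin k → V, Function.Injective f ∧ ∀ i j : Fin k, T i j → (f i, f j) ∈ M

/-- The edge set of the complete graph `K_n`. -/
def completeEdges (n : ℕ) : Finset (Sym2 (Fin n)) :=
  Finset.univ.filter fun e => ¬ e.IsDiag

/-- The edge set of the Turán graph `T_{n,k}` : classes are residues mod `k`. -/
def turanEdges (n k : ℕ) : Finset (Sym2 (Fin n)) :=
  Finset.univ.filter fun e => ¬ (e.map fun v : Fin n => v.val % k).IsDiag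

/-- `A` contains a good copy of `K_k` (all vertices in distinct classes of `T_{n,k}`). -/
def GoodCopy (n k : ℕ) (A : Finset (Sym2 (Fin n))) : Prop :=
  ∃ f : Fin k → Fin n, Function.Injective f ∧
    (∀ i j : Fin k, i ≠ j → (f i).val % k ≠ (f j).val % k) ∧
    (∀ i j : Fin k, i ≠ j → s(f i, f j) ∈ A)

open Classical in
/-- Probability that a `p`-random subset `A` of `E` (each element kept independently with
probability `p`) satisfies `P`. This is the model `G(E, p)`. -/
noncomputable def edgeProb {α : Type*} [DecidableEq α] (E : Finset α) (p : ℝ)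
    (P : Finset α → Prop) : ℝ :=
  ∑ A ∈ E.powerset, if P A then p ^ A.card * (1 - p) ^ (E.card - A.card) else 0

open Classical in
/-- Probability that a uniformly random `M`-element subset of `E` satisfies `P`.
This is the model `G(E, M)`. -/
noncomputable def uniformProb {α : Type*} [DecidableEq α] (E : Finset α) (M : ℕ)
    (P : Finset α → Prop) : ℝ :=
  ((E.powerset.filter fun A => A.card = M ∧ P A).card : ℝ) /
    ((E.powerset.filter fun A => A.card = M).card : ℝ)

/-- The three edges of a triangle on `x`, `y`, `z`. -/
def triEdges (x y z : V) : Finset (Sym2 V) := {s(x, y), s(y, z), s(x, z)}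

/-- `x`, `y`, `z` form a triangle of the graph with edge set `A`. -/
def IsTriangleIn (A : Finset (Sym2 V)) (x y z : V) : Prop :=
  x ≠ y ∧ y ≠ z ∧ x ≠ z ∧ s(x, y) ∈ A ∧ s(y, z) ∈ A ∧ s(x, z) ∈ A

/-- The triangles of `A`, each recorded as its set of three edges: the vertex set of `T_A`. -/
def TriSets (A : Finset (Sym2 V)) : Set (Finset (Sym2 V)) :=
  {t | ∃ x y z : V, IsTriangleIn A x y z ∧ t = triEdges x y z}

/-- `C` is a triangle collection: every edge lies in a triangle and the graph `T_C` of
triangles (adjacent iff sharing an edge) is connected. -/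
def IsTriangleCollection (C : Finset (Sym2 V)) : Prop :=
  (∀ e ∈ C, ∃ x y z : V, IsTriangleIn C x y z ∧ e ∈ triEdges x y z) ∧
  ∀ t ∈ TriSets C, ∀ t' ∈ TriSets C,
    Relation.ReflTransGen
      (fun a b => a ∈ TriSets C ∧ b ∈ TriSets C ∧ (a ∩ b).Nonempty) t t'

/-- Adjacency of `K₃⁺`: a triangle on `{0,1,2}` with a pendant edge `{2,3}`. -/
def K3plusAdj (a b : Fin 4) : Prop :=
  (a.val < 3 ∧ b.val < 3 ∧ a ≠ b) ∨ (a.val = 2 ∧ b.val = 3) ∨ (a.val = 3 ∧ b.val = 2)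

/-- Adjacency of the path on `Fin m`. -/
def pathAdj {m : ℕ} (a b : Fin m) : Prop := a.val + 1 = b.val ∨ b.val + 1 = a.val

/-- `C` is very basic: `T_C` is (isomorphic to) a subgraph of `K₃⁺` or of a path `P_m`. -/
def VeryBasic (C : Finset (Sym2 V)) : Prop :=
  (∃ φ : TriSets C → Fin 4, Function.Injective φ ∧
    ∀ t t' : TriSets C, t ≠ t' → ((t : Finset (Sym2 V)) ∩ (t' : Finset (Sym2 V))).Nonempty →
      K3plusAdj (φ t) (φ t')) ∨
  (∃ m : ℕ, ∃ φ : TriSets C → Fin m, Function.Injective φ ∧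
    ∀ t t' : TriSets C, t ≠ t' → ((t : Finset (Sym2 V)) ∩ (t' : Finset (Sym2 V))).Nonempty →
      pathAdj (φ t) (φ t'))

/-- `C` is basic: there are distinct edges `e₁, e₂` with `C - eᵢ` very basic for both. -/
def Basic (C : Finset (Sym2 V)) : Prop :=
  ∃ e₁ ∈ C, ∃ e₂ ∈ C, e₁ ≠ e₂ ∧ VeryBasic (C.erase e₁) ∧ VeryBasic (C.erase e₂)

open Classical in
/-- The set of non-isolated vertices of the graph with edge set `C`. -/
noncomputable def support [Fintype V] (C : Finset (Sym2 V)) : Finset V :=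
  Finset.univ.filter fun v => ∃ e ∈ C, v ∈ e

open Classical in
/-- Degree of `v` in the graph with edge set `C`. -/
noncomputable def degreeIn (C : Finset (Sym2 V)) (v : V) : ℕ :=
  (C.filter fun e => v ∈ e).card

/-- The maximum density `m(C) = max_{H ⊆ C} e(H)/v(H)` is (strictly) less than `r`. -/
def MaxDensityLt [Fintype V] (C : Finset (Sym2 V)) (r : ℝ) : Prop :=
  ∀ D ⊆ C, D.Nonempty → (D.card : ℝ) / ((support D).card : ℝ) < r

/-- The edge set of the `k`-wheel: a cycle on `{0, …, k-1} ⊆ Fin (k+1)` together with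
all edges to the center, the vertex `k`. -/
def wheelEdges (k : ℕ) : Finset (Sym2 (Fin (k + 1))) :=
  ((Finset.univ : Finset (Fin k)).image fun i =>
    s((⟨i.val, by have := i.2; omega⟩ : Fin (k + 1)),
      (⟨(i.val + 1) % k, by have := i.2; exact Nat.lt_succ_of_lt (Nat.mod_lt _ (by omega))⟩ :
        Fin (k + 1)))) ∪
  ((Finset.univ : Finset (Fin k)).image fun i =>
    s((⟨i.val, by have := i.2; omega⟩ : Fin (k + 1)), (Fin.last k)))

section Survival

variable {A E : Type*} (edge : A → E)

/-- The family of targets still open after Maker claims the arc `a`: a target containing another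
arc on the same edge is lost, and `a` no longer has to be claimed. -/
def claimArc (a : A) (𝓗 : Set (Set A)) : Set (Set A) :=
  {H' | ∃ H ∈ 𝓗, (∀ b ∈ H, edge b = edge a → b = a) ∧ H' = H \ {a}}

/-- The family of targets still open after Breaker claims the edge `e`. -/
def deleteEdge (e : E) (𝓗 : Set (Set A)) : Set (Set A) :=
  {H ∈ 𝓗 | ∀ b ∈ H, edge b ≠ e}

/-- Breaker, moving second, can prevent Maker from completing a target of `𝓗` for `n` rounds. -/
def Survives : ℕ → Set (Set A) → Prop
  | 0, 𝓗 => ∅ ∉ 𝓗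
  | n + 1, 𝓗 => ∅ ∉ 𝓗 ∧ ∀ a, ∃ e, Survives n (deleteEdge edge e (claimArc edge a 𝓗))

variable {edge}

theorem Survives.empty_notMem {n : ℕ} {𝓗 : Set (Set A)} (h : Survives edge n 𝓗) : ∅ ∉ 𝓗 := by
  cases n with
  | zero => exact h
  | succ n => exact h.1

theorem Survives.of_succ {n : ℕ} : ∀ {𝓗 : Set (Set A)}, Survives edge (n + 1) 𝓗 →
    Survives edge n 𝓗 := by
  induction n with
  | zero => intro 𝓗 h; exact h.1
  | succ n ih =>
    intro 𝓗 h
    refine ⟨h.1, fun a => ?_⟩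
    obtain ⟨e, he⟩ := h.2 a
    exact ⟨e, ih he⟩

/-- A strategy of Breaker can be pulled back along a map of arcs that separates the edges
occurring in the targets. -/
theorem Survives.comap {A' E' : Type*} {edge' : A' → E'} (φ : A → A') (U : Set A)
    (hφ : ∀ a ∈ U, ∀ b ∈ U, edge' (φ a) = edge' (φ b) → edge a = edge b) {n : ℕ} :
    ∀ {𝓖 : Set (Set A')} {𝓗 : Set (Set A)}, Survives edge' n 𝓖 →
    (∀ H ∈ 𝓗, H ⊆ U ∧ ∃ G ∈ 𝓖, G ⊆ φ '' H) → Survives edge n 𝓗 := by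
  have key : ∀ {𝓖 : Set (Set A')} {𝓗 : Set (Set A)}, ∅ ∉ 𝓖 →
      (∀ H ∈ 𝓗, H ⊆ U ∧ ∃ G ∈ 𝓖, G ⊆ φ '' H) → ∅ ∉ 𝓗 := by
    intro 𝓖 𝓗 h0 h hm
    obtain ⟨-, G, hG, hs⟩ := h _ hm
    simp only [Set.image_empty, Set.subset_empty_iff] at hs
    exact h0 (hs ▸ hG)
  induction n with
  | zero => intro 𝓖 𝓗 h h'; exact key h h'
  | succ n ih =>
    intro 𝓖 𝓗 h h'
    refine ⟨key h.1 h', fun a => ?_⟩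
    by_cases ha : a ∈ U
    · obtain ⟨e', he'⟩ := h.2 (φ a)
      obtain ⟨e, he⟩ : ∃ e : E, ∀ b ∈ U, edge' (φ b) = e' → edge b = e := by
        by_cases hx : ∃ c ∈ U, edge' (φ c) = e'
        · obtain ⟨c, hc, rfl⟩ := hx
          exact ⟨edge c, fun b hb hbc => hφ b hb c hc hbc⟩
        · push Not at hx
          exact ⟨edge a, fun b hb hbc => (hx b hb hbc).elim⟩
      refine ⟨e, ih he' ?_⟩
      rintro H' ⟨⟨H, hH, hHa, rfl⟩, hHe⟩
      obtain ⟨hHU, G, hG, hGs⟩ := h' H hH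
      refine ⟨fun b hb => hHU hb.1, G \ {φ a}, ⟨⟨G, hG, ?_, rfl⟩, ?_⟩, ?_⟩
      · intro c hc hce
        obtain ⟨b, hb, rfl⟩ := hGs hc
        rw [hHa b hb (hφ b (hHU hb) a ha hce)]
      · rintro c ⟨hc, hca⟩ hce
        obtain ⟨b, hb, rfl⟩ := hGs hc
        have hba : b ≠ a := fun hba => hca (by rw [hba]; rfl)
        exact hHe b ⟨hb, hba⟩ (he b (hHU hb) hce)
      · rintro c ⟨hc, hca⟩
        obtain ⟨b, hb, rfl⟩ := hGs hc
        have hba : b ≠ a := fun hba => hca (by rw [hba]; rfl)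
        exact ⟨b, ⟨hb, hba⟩, rfl⟩
    · refine ⟨edge a, ih h.of_succ ?_⟩
      rintro H' ⟨⟨H, hH, hHa, rfl⟩, hHe⟩
      obtain ⟨hHU, G, hG, hGs⟩ := h' H hH
      have : H \ {a} = H := Set.sdiff_singleton_eq_self fun haH => ha (hHU haH)
      rw [this]
      exact ⟨hHU, G, hG, hGs⟩

theorem Survives.mono {n : ℕ} {𝓖 𝓗 : Set (Set A)} (h : Survives edge n 𝓖)
    (h' : ∀ H ∈ 𝓗, ∃ G ∈ 𝓖, G ⊆ H) : Survives edge n 𝓗 := by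
  refine h.comap id Set.univ (fun _ _ _ _ h => h) fun H hH => ⟨Set.subset_univ _, ?_⟩
  simpa using h' H hH

theorem survives_empty (n : ℕ) : Survives edge n (∅ : Set (Set A)) := by
  induction n with
  | zero => exact Set.notMem_empty _
  | succ n ih =>
    refine ⟨Set.notMem_empty _, fun a => ⟨edge a, ih.mono ?_⟩⟩
    rintro H ⟨⟨G, hG, -⟩, -⟩
    exact hG.elim

theorem Survives.union {n : ℕ} : ∀ {𝓖 𝓗 : Set (Set A)}, Survives edge n 𝓖 → Survives edge n 𝓗 →
    (∀ G ∈ 𝓖, ∀ H ∈ 𝓗, ∀ a ∈ G, ∀ b ∈ H, edge a ≠ edge b) → Survives edge n (𝓖 ∪ 𝓗) := by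
  induction n with
  | zero =>
    intro 𝓖 𝓗 hG hH _ h
    exact h.elim hG hH
  | succ n ih =>
    intro 𝓖 𝓗 hG hH hd
    refine ⟨fun h => h.elim hG.1 hH.1, fun a => ?_⟩
    have claim_fst : ∀ {𝓖 𝓗 : Set (Set A)}, Survives edge (n + 1) 𝓖 → Survives edge (n + 1) 𝓗 →
        (∀ G ∈ 𝓖, ∀ H ∈ 𝓗, ∀ a ∈ G, ∀ b ∈ H, edge a ≠ edge b) →
        (∀ H ∈ 𝓗, ∀ b ∈ H, edge b ≠ edge a) →
        ∃ e, Survives edge n (deleteEdge edge e (claimArc edge a (𝓖 ∪ 𝓗))) := by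
      intro 𝓖 𝓗 hG hH hd ha
      obtain ⟨e, he⟩ := hG.2 a
      refine ⟨e, (ih he hH.of_succ ?_).mono ?_⟩
      · rintro G ⟨⟨G, hG, -, rfl⟩, -⟩ H hH b hb c hc
        exact hd G hG H hH b hb.1 c hc
      · rintro H' ⟨⟨H, hH | hH, hHa, rfl⟩, hHe⟩
        · exact ⟨_, Or.inl ⟨⟨H, hH, hHa, rfl⟩, hHe⟩, subset_rfl⟩
        · refine ⟨H, Or.inr hH, fun b hb => ⟨hb, ?_⟩⟩
          rintro rfl
          exact ha H hH b hb rfl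
    by_cases ha : ∀ H ∈ 𝓗, ∀ b ∈ H, edge b ≠ edge a
    · exact claim_fst hG hH hd ha
    · push Not at ha
      obtain ⟨H, hH', b, hb, hba⟩ := ha
      rw [Set.union_comm]
      refine claim_fst hH hG (fun G hG H hH a ha b hb h => hd H hH G hG b hb a ha h.symm) ?_
      intro G hG c hc hca
      exact hd G hG H hH' c hc b hb (hca.trans hba.symm)

theorem survives_of_pair {e f : E} (hef : e ≠ f) {n : ℕ} : ∀ {𝓗 : Set (Set A)},
    (∀ H ∈ 𝓗, (∃ a ∈ H, edge a = e) ∧ ∃ a ∈ H, edge a = f) → Survives edge n 𝓗 := by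
  have key : ∀ {𝓗 : Set (Set A)},
      (∀ H ∈ 𝓗, (∃ a ∈ H, edge a = e) ∧ ∃ a ∈ H, edge a = f) → ∅ ∉ 𝓗 := by
    intro 𝓗 h h0
    obtain ⟨⟨a, ha, -⟩, -⟩ := h _ h0
    exact ha
  induction n with
  | zero => intro 𝓗 h; exact key h
  | succ n ih =>
    intro 𝓗 h
    refine ⟨key h, fun c => ?_⟩
    by_cases hce : edge c = e
    · refine ⟨f, (survives_empty n).mono ?_⟩
      rintro H' ⟨⟨H, hH, hHa, rfl⟩, hHe⟩
      obtain ⟨-, a, ha, rfl⟩ := h H hH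
      refine absurd rfl (hHe a ⟨ha, ?_⟩)
      rintro rfl
      exact hef hce.symm
    · by_cases hcf : edge c = f
      · refine ⟨e, (survives_empty n).mono ?_⟩
        rintro H' ⟨⟨H, hH, hHa, rfl⟩, hHe⟩
        obtain ⟨⟨a, ha, rfl⟩, -⟩ := h H hH
        refine absurd rfl (hHe a ⟨ha, ?_⟩)
        rintro rfl
        exact hef hcf
      · refine ⟨edge c, ih ?_⟩
        rintro H' ⟨⟨H, hH, hHa, rfl⟩, hHe⟩
        obtain ⟨⟨a, ha, hae⟩, b, hb, hbf⟩ := h H hH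
        exact ⟨⟨a, ⟨ha, by rintro rfl; exact hce hae⟩, hae⟩,
          b, ⟨hb, by rintro rfl; exact hcf hbf⟩, hbf⟩

/-- Targets using both edges of a pair can be ignored if no other target uses that pair. -/
theorem Survives.of_pair {e f : E} (hef : e ≠ f) {n : ℕ} {𝓖 𝓗 : Set (Set A)}
    (hG : Survives edge n 𝓖) (hd : ∀ G ∈ 𝓖, ∀ a ∈ G, edge a ≠ e ∧ edge a ≠ f)
    (h : ∀ H ∈ 𝓗, (∃ G ∈ 𝓖, G ⊆ H) ∨ (∃ a ∈ H, edge a = e) ∧ ∃ a ∈ H, edge a = f) :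
    Survives edge n 𝓗 := by
  let 𝓟 : Set (Set A) := {P | (∀ a ∈ P, edge a = e ∨ edge a = f) ∧
    (∃ a ∈ P, edge a = e) ∧ ∃ a ∈ P, edge a = f}
  have hP : Survives edge n 𝓟 := survives_of_pair hef fun P hP => hP.2
  refine (hG.union hP ?_).mono ?_
  · intro G hG P hP a ha b hb hab
    rcases hP.1 b hb with hb | hb
    · exact (hd G hG a ha).1 (hab.trans hb)
    · exact (hd G hG a ha).2 (hab.trans hb)
  · intro H hH
    rcases h H hH with ⟨G, hG, hGH⟩ | ⟨⟨a, ha, hae⟩, b, hb, hbf⟩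
    · exact ⟨G, Or.inl hG, hGH⟩
    · exact ⟨{c ∈ H | edge c = e ∨ edge c = f}, Or.inr ⟨fun c hc => hc.2,
        ⟨a, ⟨ha, Or.inl hae⟩, hae⟩, b, ⟨hb, Or.inr hbf⟩, hbf⟩, fun c hc => hc.1⟩

end Survival

/-- The edge underlying an arc. -/
def arcEdge {V : Type*} (a : V × V) : Sym2 V := s(a.1, a.2)

/-- The arc set of the directed triangle `x → y → z → x`. -/
def cyclicArcs {V : Type*} (x y z : V) : Set (V × V) := {(x, y), (y, z), (z, x)}

/-- The arc sets of the directed triangles on the board `X`. -/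
def cyclicTriangles {V : Type*} (X : Finset (Sym2 V)) : Set (Set (V × V)) :=
  {H | ∃ x y z : V, x ≠ y ∧ y ≠ z ∧ x ≠ z ∧ s(x, y) ∈ X ∧ s(y, z) ∈ X ∧ s(z, x) ∈ X ∧
    H = cyclicArcs x y z}

theorem cyclicArcs_rotate {V : Type*} (x y z : V) : cyclicArcs x y z = cyclicArcs y z x := by
  ext a
  simp only [cyclicArcs, Set.mem_insert_iff, Set.mem_singleton_iff]
  tauto

theorem cyclicTriangles_mono {V : Type*} {X Y : Finset (Sym2 V)} (h : X ⊆ Y) :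
    cyclicTriangles X ⊆ cyclicTriangles Y := by
  rintro H ⟨x, y, z, h1, h2, h3, h4, h5, h6, rfl⟩
  exact ⟨x, y, z, h1, h2, h3, h h4, h h5, h h6, rfl⟩

theorem arcEdge_mem_of_mem_cyclicTriangles {V : Type*} {X : Finset (Sym2 V)} {H : Set (V × V)}
    (hH : H ∈ cyclicTriangles X) {a : V × V} (ha : a ∈ H) : arcEdge a ∈ X := by
  obtain ⟨x, y, z, -, -, -, h4, h5, h6, rfl⟩ := hH
  rcases ha with rfl | rfl | rfl <;> assumption

section Position

variable {V : Type*} [DecidableEq V]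

theorem undirect_insert (x y : V) (M : Finset (V × V)) :
    undirect (insert (x, y) M) = insert s(x, y) (undirect M) := by
  simp [undirect]

theorem arcEdge_mem_undirect {M : Finset (V × V)} {a : V × V} (ha : a ∈ M) :
    arcEdge a ∈ undirect M :=
  Finset.mem_image_of_mem _ ha

/-- The directed triangles Maker can still complete, reduced to their unclaimed arcs. -/
def openTriangles (X : Finset (Sym2 V)) (M : Finset (V × V)) (B : Finset (Sym2 V)) :
    Set (Set (V × V)) :=
  {H' | ∃ H ∈ cyclicTriangles X, (∀ a ∈ H, arcEdge a ∈ undirect M → a ∈ M) ∧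
    (∀ a ∈ H, arcEdge a ∉ B) ∧ H' = H \ ↑M}

theorem not_hasCyclicTriangle_of_survives {X : Finset (Sym2 V)} {M : Finset (V × V)}
    {B : Finset (Sym2 V)} (hMX : undirect M ⊆ X) (hMB : Disjoint (undirect M) B) {n : ℕ}
    (h : Survives arcEdge n (openTriangles X M B)) : ¬ HasCyclicTriangle M := by
  rintro ⟨x, y, z, hxy, hyz, hxz, h1, h2, h3⟩
  have hsub : cyclicArcs x y z ⊆ ↑M := by
    rintro a (rfl | rfl | rfl) <;> assumption
  refine h.empty_notMem ⟨cyclicArcs x y z, ⟨x, y, z, hxy, hyz, hxz, hMX (arcEdge_mem_undirect h1),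
    hMX (arcEdge_mem_undirect h2), hMX (arcEdge_mem_undirect h3), rfl⟩, fun a ha _ => hsub ha,
    fun a ha => Finset.disjoint_left.1 hMB (arcEdge_mem_undirect (hsub ha)), ?_⟩
  exact (Set.sdiff_eq_empty.2 hsub).symm

theorem openTriangles_step {X : Finset (Sym2 V)} {M : Finset (V × V)} {B R : Finset (Sym2 V)}
    {x y : V} {e : Sym2 V} (hxy : s(x, y) ∉ undirect M)
    (he : e ∈ X \ (insert s(x, y) (undirect M) ∪ B) → e ∈ R) :
    ∀ H ∈ openTriangles X (insert (x, y) M) (B ∪ R),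
      H ∈ deleteEdge arcEdge e (claimArc arcEdge (x, y) (openTriangles X M B)) := by
  rintro H' ⟨H, hH, hHM, hHB, rfl⟩
  have hxyM : ∀ {a}, a ∈ insert (x, y) M → arcEdge a = s(x, y) → a = (x, y) := by
    intro a ha hae
    rcases Finset.mem_insert.1 ha with h | h
    · exact h
    · exact absurd (hae ▸ arcEdge_mem_undirect h) hxy
  refine ⟨⟨H \ ↑M, ⟨H, hH, ?_, ?_, rfl⟩, ?_, ?_⟩, ?_⟩
  · intro a ha haM
    rcases Finset.mem_insert.1 (hHM a ha (by
      rw [undirect_insert]; exact Finset.mem_insert_of_mem haM)) with rfl | h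
    · exact absurd haM hxy
    · exact h
  · intro a ha haB
    exact hHB a ha (Finset.mem_union_left _ haB)
  · intro b hb hbe
    exact hxyM (hHM b hb.1 (by rw [undirect_insert, hbe]; exact Finset.mem_insert_self _ _)) hbe
  · ext a
    simp only [Finset.coe_insert, Set.mem_sdiff, Set.mem_insert_iff, Finset.mem_coe,
      Set.mem_singleton_iff]
    tauto
  · rintro b ⟨hb, hbM⟩ rfl
    have hbR : arcEdge b ∉ B ∪ R := hHB b hb
    rw [Finset.mem_union, not_or] at hbR
    refine hbR.2 (he (Finset.mem_sdiff.2 ⟨arcEdge_mem_of_mem_cyclicTriangles hH hb, ?_⟩))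
    rw [Finset.mem_union, not_or, ← undirect_insert]
    exact ⟨fun h => hbM (hHM b hb h), hbR.1⟩

theorem oBreakerBlock_of_survives (X : Finset (Sym2 V)) (n : ℕ) :
    ∀ (M : Finset (V × V)) (B : Finset (Sym2 V)), undirect M ⊆ X → Disjoint (undirect M) B →
    (X \ (undirect M ∪ B)).card ≤ n → Survives arcEdge n (openTriangles X M B) →
    OBreakerBlock X HasCyclicTriangle 1 M B := by
  induction n with
  | zero =>
    intro M B hMX hMB hcard h
    have hfree : ∀ x y : V, s(x, y) ∈ X → ¬ s(x, y) ∉ undirect M ∪ B := by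
      intro x y hx hn
      have := Finset.card_pos.2 ⟨_, Finset.mem_sdiff.2 ⟨hx, hn⟩⟩
      omega
    exact .step M B (not_hasCyclicTriangle_of_survives hMX hMB h) (fun _ _ => ∅)
      (fun x y hx hn => absurd hn (hfree x y hx)) (fun x y hx hn => absurd hn (hfree x y hx))
      (fun x y hx hn => absurd hn (hfree x y hx))
  | succ n ih =>
    intro M B hMX hMB hcard h
    have hresp : ∀ x y : V, ∃ R : Finset (Sym2 V), s(x, y) ∈ X → s(x, y) ∉ undirect M ∪ B →
        R ⊆ X \ (insert s(x, y) (undirect M) ∪ B) ∧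
        R.card = min 1 (X \ (insert s(x, y) (undirect M) ∪ B)).card ∧
        OBreakerBlock X HasCyclicTriangle 1 (insert (x, y) M) (B ∪ R) := by
      intro x y
      by_cases hleg : s(x, y) ∈ X ∧ s(x, y) ∉ undirect M ∪ B
      swap
      · exact ⟨∅, fun h1 h2 => absurd ⟨h1, h2⟩ hleg⟩
      obtain ⟨hx, hn⟩ := hleg
      rw [Finset.mem_union, not_or] at hn
      obtain ⟨e, he⟩ := h.2 (x, y)
      obtain ⟨R, hR, hRc, heR⟩ : ∃ R : Finset (Sym2 V),
          R ⊆ X \ (insert s(x, y) (undirect M) ∪ B) ∧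
          R.card = min 1 (X \ (insert s(x, y) (undirect M) ∪ B)).card ∧
          (e ∈ X \ (insert s(x, y) (undirect M) ∪ B) → e ∈ R) := by
        generalize X \ (insert s(x, y) (undirect M) ∪ B) = F
        rcases F.eq_empty_or_nonempty with rfl | ⟨f, hf⟩
        · exact ⟨∅, by simp⟩
        · have hF : 1 ≤ F.card := Finset.card_pos.2 ⟨f, hf⟩
          by_cases heF : e ∈ F
          · exact ⟨{e}, by simpa using heF, by rw [Finset.card_singleton]; omega, by simp⟩
          · exact ⟨{f}, by simpa using hf, by rw [Finset.card_singleton]; omega, fun h => absurd h heF⟩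
      refine ⟨R, fun _ _ => ⟨hR, hRc, ih _ _ ?_ ?_ ?_ ?_⟩⟩
      · rw [undirect_insert]
        exact Finset.insert_subset hx hMX
      · rw [undirect_insert, Finset.disjoint_union_right, Finset.disjoint_insert_left]
        refine ⟨⟨hn.2, hMB⟩, Finset.disjoint_left.2 fun f hf hfR => ?_⟩
        exact (Finset.mem_sdiff.1 (hR hfR)).2 (Finset.mem_union_left _ hf)
      · have hlt : (X \ (undirect (insert (x, y) M) ∪ (B ∪ R))).card <
            (X \ (undirect M ∪ B)).card := by
          refine Finset.card_lt_card (Finset.ssubset_iff_of_subset ?_ |>.2 ⟨s(x, y), ?_, ?_⟩)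
          · rw [undirect_insert]
            intro f
            simp only [Finset.mem_sdiff, Finset.mem_union, Finset.mem_insert]
            tauto
          · simp [hx, hn]
          · simp [undirect_insert]
        omega
      · exact he.mono fun H hH => ⟨H, openTriangles_step hn.1 heR H hH, subset_rfl⟩
    choose resp hresp using hresp
    exact .step M B (not_hasCyclicTriangle_of_survives hMX hMB h) resp
      (fun x y hx hn => (hresp x y hx hn).1) (fun x y hx hn => (hresp x y hx hn).2.1)
      (fun x y hx hn => (hresp x y hx hn).2.2)

theorem oBreakerBlock_of_survives_cyclicTriangles {X : Finset (Sym2 V)}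
    (h : ∀ n, Survives arcEdge n (cyclicTriangles X)) :
    OBreakerBlock X HasCyclicTriangle 1 ∅ ∅ := by
  refine oBreakerBlock_of_survives X _ ∅ ∅ (by simp [undirect]) (by simp [undirect]) le_rfl
    ((h _).mono ?_)
  rintro H' ⟨H, hH, -, -, rfl⟩
  exact ⟨H, hH, by simp⟩

end Position

/-- `f n`, arranged so that the kernel evaluates `n` first. -/
def force {α : Type} (n : ℕ) (f : ℕ → α) : α := Nat.rec (f 0) (fun k _ => f (Nat.succ k)) n

theorem force_eq {α : Type} (n : ℕ) (f : ℕ → α) : force n f = f n := by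
  cases n <;> rfl

/-- The elements of the bitmask `T` outside the bitmask `m`. -/
def maskDiff (T m : ℕ) : ℕ := Nat.xor T (Nat.land T m)

/-- The targets in `T` using the edge `q.1`, whose two arcs lie in the targets `q.2.1` and
`q.2.2` respectively. -/
def usedIn (T : ℕ) (q : ℕ × ℕ × ℕ) : ℕ := Nat.land T (Nat.lor q.2.1 q.2.2)

/-- The targets in `T` using some edge of `es` that is contained in the same targets in `T`
as the edge `q`. -/
def pairedWith (T : ℕ) (q : ℕ × ℕ × ℕ) : List (ℕ × ℕ × ℕ) → ℕ
  | [] => 0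
  | r :: es => bif Nat.beq (usedIn T q) (usedIn T r) && !Nat.beq q.1 r.1 then usedIn T q
      else pairedWith T q es

def pairedTargets (T : ℕ) : List (ℕ × ℕ × ℕ) → ℕ
  | [] => 0
  | q :: es => bif Nat.beq (pairedWith T q es) 0 then pairedTargets T es else pairedWith T q es

/-- Repeatedly discard the targets blocked by a pairing. -/
def collapse (es : List (ℕ × ℕ × ℕ)) : ℕ → ℕ → ℕ
  | 0, T => T
  | m + 1, T => force (pairedTargets T es) fun P => bif Nat.beq P 0 then T
      else force (maskDiff T P) (collapse es m)

/-- The targets using at least one, respectively at least two, of the edges in `es`. -/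
def onceTwice : List (ℕ × ℕ × ℕ) → ℕ × ℕ
  | [] => (0, 0)
  | q :: es =>
    let m := Nat.lor q.2.1 q.2.2
    let r := onceTwice es
    (Nat.lor m r.1, Nat.lor r.2 (Nat.land m r.1))

/-- The edges of `es` other than `e`. -/
def without (e : ℕ) : List (ℕ × ℕ × ℕ) → List (ℕ × ℕ × ℕ)
  | [] => []
  | q :: es => bif Nat.beq e q.1 then without e es else q :: without e es

/-- A sound test for Breaker surviving on the targets `T`, with search depth `fuel`. -/
def survivesCode : ℕ → List (ℕ × ℕ × ℕ) → ℕ → Bool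
  | 0, es, T => Nat.beq (collapse es 10 T) 0
  | fuel + 1, es, T =>
    force (collapse es 10 T) fun T' =>
    Nat.beq T' 0 || Nat.beq (maskDiff T' (onceTwice es).1) 0 && es.all fun q =>
      let es' := without q.1 es
      let o := onceTwice es'
      let resp := fun T₁ =>
        force (maskDiff (Nat.land T₁ o.1) o.2) fun s =>
        es'.any fun r => !Nat.beq (usedIn T₁ r) 0 && (Nat.beq s 0 || !Nat.beq (usedIn s r) 0) &&
          force (maskDiff T₁ (usedIn T₁ r)) (survivesCode fuel es')
      (Nat.beq (Nat.land T' q.2.1) 0 || force (maskDiff T' q.2.2) resp) &&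
      (Nat.beq (Nat.land T' q.2.2) 0 || force (maskDiff T' q.2.1) resp)

/-- The arcs used by the target number `t`. -/
def codeArcs (es : List (ℕ × ℕ × ℕ)) (t : ℕ) : Set (ℕ × Bool) :=
  {a | ∃ q ∈ es, a.1 = q.1 ∧ (bif a.2 then q.2.2 else q.2.1).testBit t}

/-- The family of targets described by `es` and `T`. -/
def codeTargets (es : List (ℕ × ℕ × ℕ)) (T : ℕ) : Set (Set (ℕ × Bool)) :=
  {H | ∃ t, T.testBit t ∧ H = codeArcs es t}

theorem testBit_maskDiff (T m t : ℕ) :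
    (maskDiff T m).testBit t = (T.testBit t && !m.testBit t) := by
  change (T ^^^ (T &&& m)).testBit t = _
  rw [Nat.testBit_xor, Nat.testBit_and]
  cases T.testBit t <;> cases m.testBit t <;> rfl

theorem testBit_usedIn (T t : ℕ) (q : ℕ × ℕ × ℕ) :
    (usedIn T q).testBit t = (T.testBit t && (q.2.1.testBit t || q.2.2.testBit t)) := by
  change (T &&& (q.2.1 ||| q.2.2)).testBit t = _
  rw [Nat.testBit_and, Nat.testBit_or]

theorem eq_of_beq_nat {m n : ℕ} (h : Nat.beq m n = true) : m = n := Nat.eq_of_beq_eq_true h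

theorem ne_of_beq_nat {m n : ℕ} (h : Nat.beq m n = false) : m ≠ n := Nat.ne_of_beq_eq_false h

theorem exists_of_pairedWith_ne_zero {T : ℕ} {q : ℕ × ℕ × ℕ} {es : List (ℕ × ℕ × ℕ)}
    (h : pairedWith T q es ≠ 0) : pairedWith T q es = usedIn T q ∧
      ∃ r ∈ es, q.1 ≠ r.1 ∧ usedIn T q = usedIn T r := by
  induction es with
  | nil => exact absurd rfl h
  | cons r es ih =>
    rw [pairedWith] at h ⊢
    cases hc : Nat.beq (usedIn T q) (usedIn T r) && !Nat.beq q.1 r.1 with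
    | true =>
      rw [Bool.and_eq_true, Bool.not_eq_true'] at hc
      exact ⟨rfl, r, List.mem_cons_self, ne_of_beq_nat hc.2, eq_of_beq_nat hc.1⟩
    | false =>
      rw [hc] at h
      obtain ⟨h1, r', hr', h2⟩ := ih h
      exact ⟨h1, r', List.mem_cons_of_mem _ hr', h2⟩

theorem exists_of_pairedTargets_ne_zero {T : ℕ} {es : List (ℕ × ℕ × ℕ)}
    (h : pairedTargets T es ≠ 0) : ∃ q ∈ es, ∃ r ∈ es, q.1 ≠ r.1 ∧ usedIn T q = usedIn T r ∧
      pairedTargets T es = usedIn T q := by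
  induction es with
  | nil => exact absurd rfl h
  | cons q es ih =>
    rw [pairedTargets] at h ⊢
    cases hc : Nat.beq (pairedWith T q es) 0 with
    | true =>
      rw [hc] at h
      obtain ⟨q', hq', r, hr, h'⟩ := ih h
      exact ⟨q', List.mem_cons_of_mem _ hq', r, List.mem_cons_of_mem _ hr, h'⟩
    | false =>
      obtain ⟨h1, r, hr, h2, h3⟩ := exists_of_pairedWith_ne_zero (ne_of_beq_nat hc)
      exact ⟨q, List.mem_cons_self, r, List.mem_cons_of_mem _ hr, h2, h3, h1⟩

theorem eq_of_mem_of_nodup_fst {es : List (ℕ × ℕ × ℕ)} (hes : (es.map Prod.fst).Nodup)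
    {q r : ℕ × ℕ × ℕ} (hq : q ∈ es) (hr : r ∈ es) (h : q.1 = r.1) : q = r :=
  List.inj_on_of_nodup_map hes hq hr h

theorem exists_mem_codeArcs {es : List (ℕ × ℕ × ℕ)} {T t : ℕ} {q : ℕ × ℕ × ℕ} (hq : q ∈ es)
    (h : (usedIn T q).testBit t) : ∃ a ∈ codeArcs es t, a.1 = q.1 := by
  rw [testBit_usedIn, Bool.and_eq_true, Bool.or_eq_true] at h
  rcases h.2 with h | h
  · exact ⟨(q.1, false), ⟨q, hq, rfl, h⟩, rfl⟩
  · exact ⟨(q.1, true), ⟨q, hq, rfl, h⟩, rfl⟩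

theorem Survives.of_collapse {es : List (ℕ × ℕ × ℕ)} (hes : (es.map Prod.fst).Nodup) {n : ℕ}
    (m : ℕ) : ∀ {T : ℕ}, Survives Prod.fst n (codeTargets es (collapse es m T)) →
      Survives Prod.fst n (codeTargets es T) := by
  induction m with
  | zero => exact fun h => h
  | succ m ih =>
    intro T h
    rw [collapse, force_eq, force_eq] at h
    cases hc : Nat.beq (pairedTargets T es) 0 with
    | true => rwa [hc] at h
    | false =>
      rw [hc] at h
      obtain ⟨q, hq, r, hr, hqr, hu, he⟩ := exists_of_pairedTargets_ne_zero (ne_of_beq_nat hc)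
      have hd : ∀ {t : ℕ}, (maskDiff T (usedIn T q)).testBit t → ∀ a ∈ codeArcs es t,
          ∀ q' ∈ es, usedIn T q = usedIn T q' → a.1 ≠ q'.1 := by
        rintro t ht a ⟨q₀, hq₀, ha, hat⟩ q' hq' hqq' haq'
        obtain rfl := eq_of_mem_of_nodup_fst hes hq₀ hq' (ha.symm.trans haq')
        rw [hqq', testBit_maskDiff, testBit_usedIn] at ht
        cases ha2 : a.2 <;> rw [ha2] at hat <;> simp_all
      refine (ih h).of_pair hqr ?_ ?_
      · rintro G ⟨t, ht, rfl⟩ a ha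
        rw [he] at ht
        exact ⟨hd ht a ha q hq rfl, hd ht a ha r hr hu⟩
      · rintro H ⟨t, ht, rfl⟩
        by_cases htq : (usedIn T q).testBit t
        · exact Or.inr ⟨exists_mem_codeArcs hq htq, exists_mem_codeArcs hr (hu ▸ htq)⟩
        · refine Or.inl ⟨_, ⟨t, ?_, rfl⟩, subset_rfl⟩
          rw [he, testBit_maskDiff, ht]
          simpa using htq

theorem codeTargets_zero (es : List (ℕ × ℕ × ℕ)) : codeTargets es 0 = ∅ := by
  refine Set.eq_empty_of_forall_notMem ?_
  rintro H ⟨t, ht, -⟩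
  simp at ht

theorem mem_without {e : ℕ} {es : List (ℕ × ℕ × ℕ)} {q : ℕ × ℕ × ℕ} :
    q ∈ without e es ↔ q ∈ es ∧ e ≠ q.1 := by
  induction es with
  | nil => simp [without]
  | cons r es ih =>
    rw [without]
    cases hc : Nat.beq e r.1 with
    | true =>
      rw [cond_true, ih, List.mem_cons]
      have := eq_of_beq_nat hc
      grind
    | false =>
      rw [cond_false, List.mem_cons, ih, List.mem_cons]
      have := ne_of_beq_nat hc
      grind

theorem without_sublist (e : ℕ) (es : List (ℕ × ℕ × ℕ)) : (without e es).Sublist es := by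
  induction es with
  | nil => exact List.Sublist.refl _
  | cons r es ih =>
    rw [without]
    cases Nat.beq e r.1 with
    | true => exact ih.cons _
    | false => exact ih.cons_cons _

theorem exists_of_testBit_onceTwice {es : List (ℕ × ℕ × ℕ)} {t : ℕ}
    (h : (onceTwice es).1.testBit t) : ∃ a, a ∈ codeArcs es t := by
  induction es with
  | nil => simp [onceTwice] at h
  | cons q es ih =>
    change ((q.2.1 ||| q.2.2) ||| (onceTwice es).1).testBit t = true at h
    rw [Nat.testBit_or, Nat.testBit_or, Bool.or_eq_true, Bool.or_eq_true] at h
    rcases h with (h | h) | h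
    · exact ⟨(q.1, false), q, List.mem_cons_self, rfl, h⟩
    · exact ⟨(q.1, true), q, List.mem_cons_self, rfl, h⟩
    · obtain ⟨a, r, hr, ha⟩ := ih h
      exact ⟨a, r, List.mem_cons_of_mem _ hr, ha⟩

theorem survives_of_survivesCode {fuel : ℕ} : ∀ {es : List (ℕ × ℕ × ℕ)} {T : ℕ},
    (es.map Prod.fst).Nodup → survivesCode fuel es T = true →
      ∀ n, Survives Prod.fst n (codeTargets es T) := by
  induction fuel with
  | zero =>
    intro es T hes h n
    refine Survives.of_collapse hes 10 ?_
    rw [survivesCode] at h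
    rw [eq_of_beq_nat h, codeTargets_zero]
    exact survives_empty n
  | succ fuel ih =>
    intro es T hes h n
    refine Survives.of_collapse hes 10 ?_
    rw [survivesCode] at h
    simp only [force_eq] at h
    generalize collapse es 10 T = T' at h ⊢
    simp only [Bool.or_eq_true, Bool.and_eq_true, List.all_eq_true, List.any_eq_true] at h
    rcases h with h | ⟨hcov, h⟩
    · rw [eq_of_beq_nat h, codeTargets_zero]
      exact survives_empty n
    have hne : ∅ ∉ codeTargets es T' := by
      rintro ⟨t, ht, h0⟩
      have h1 := testBit_maskDiff T' (onceTwice es).1 t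
      rw [eq_of_beq_nat hcov, Nat.zero_testBit, ht] at h1
      obtain ⟨a, ha⟩ := exists_of_testBit_onceTwice (es := es) (t := t) (by simpa using h1.symm)
      rw [← h0] at ha
      exact ha
    induction n with
    | zero => exact hne
    | succ n ihn =>
      refine ⟨hne, fun a => ?_⟩
      by_cases hrel : ∃ t, T'.testBit t ∧ a ∈ codeArcs es t
      · obtain ⟨t₀, ht₀, q, hq, haq, hat⟩ := hrel
        obtain ⟨r, hr, hs⟩ : ∃ r ∈ without q.1 es, survivesCode fuel (without q.1 es)
            (maskDiff (maskDiff T' (bif a.2 then q.2.1 else q.2.2))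
              (usedIn (maskDiff T' (bif a.2 then q.2.1 else q.2.2)) r)) = true := by
          have hland : Nat.beq (Nat.land T' (bif a.2 then q.2.2 else q.2.1)) 0 ≠ true := by
            intro h0
            have h1 : (T' &&& (bif a.2 then q.2.2 else q.2.1)).testBit t₀ = true := by
              rw [Nat.testBit_and, ht₀, hat]; rfl
            change (Nat.land T' (bif a.2 then q.2.2 else q.2.1)).testBit t₀ = true at h1
            rw [eq_of_beq_nat h0] at h1
            simp at h1
          cases ha2 : a.2 <;> rw [ha2] at hland
          · obtain ⟨r, hr, h1⟩ := (h q hq).1.resolve_left hland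
            exact ⟨r, hr, h1.2⟩
          · obtain ⟨r, hr, h1⟩ := (h q hq).2.resolve_left hland
            exact ⟨r, hr, h1.2⟩
        refine ⟨r.1, (ih (hes.sublist ((without_sublist _ _).map _)) hs n).mono ?_⟩
        rintro H' ⟨⟨H, ⟨t, ht, rfl⟩, hHa, rfl⟩, hHe⟩
        have hrev : (bif a.2 then q.2.1 else q.2.2).testBit t = false := by
          by_contra hb
          rw [Bool.not_eq_false] at hb
          have := hHa (a.1, !a.2) ⟨q, hq, haq, by cases ha2 : a.2 <;> simpa [ha2] using hb⟩ rfl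
          have := congrArg Prod.snd this
          simp at this
        refine ⟨_, ⟨t, ?_, rfl⟩, ?_⟩
        · rw [testBit_maskDiff, testBit_maskDiff, ht, hrev, Bool.true_and, Bool.not_false,
            Bool.true_and, Bool.not_eq_true', ← Bool.not_eq_true]
          intro hu
          obtain ⟨b, hb, hbr⟩ := exists_mem_codeArcs (mem_without.1 hr).1 hu
          refine hHe b ⟨hb, ?_⟩ hbr
          rintro rfl
          exact (mem_without.1 hr).2 (haq.symm.trans hbr)
        · rintro b ⟨q', hq', hbq', hbt⟩
          refine ⟨⟨q', (mem_without.1 hq').1, hbq', hbt⟩, ?_⟩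
          rintro rfl
          exact (mem_without.1 hq').2 (haq.symm.trans hbq')
      · refine ⟨a.1, ihn.mono ?_⟩
        rintro H' ⟨⟨H, ⟨t, ht, rfl⟩, hHa, rfl⟩, hHe⟩
        refine ⟨_, ⟨t, ht, rfl⟩, fun b hb => ⟨hb, ?_⟩⟩
        rintro rfl
        exact hrel ⟨t, ht, hb⟩

/-- The board of the complete graph on `{0, …, 6}`: the edge between `i < j` has the code `8 * j + i`
and the targets are the `70` directed triangles, or the `35` undirected ones. -/
def completeBoard (o : Bool) : List (ℕ × ℕ × ℕ) :=
  bif o then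
    [(8, 341, 682), (16, 87042, 174081), (17, 91268055041, 182536110082), (24, 5507080, 11011076),
     (25, 5774583529476, 11545945833480), (26, 23643899117437952, 47287798234875904),
     (32, 84418592, 168038416), (33, 88519275970576, 176201033318432),
     (34, 362539774298296320, 721701848876064768),
     (35, 23059556266921951232, 46119112533843902464), (40, 304119936, 554713152),
     (41, 318892731793472, 581658830962816), (42, 1306043909117329408, 2382404237238763520),
     (43, 83014853030833029120, 152194648006383894528),
     (44, 299831666384020963328, 599663332768041926656), (48, 679608832, 339804416),
     (49, 712620973752576, 356310486876672), (50, 2918332627255623680, 1459166416707125248),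
     (51, 184485459533655703552, 92269757961668132864),
     (52, 609030855177378201600, 332617994816697925632),
     (53, 370088084454043025408, 740176168908086050816)]
  else
    [(8, 31, 0), (16, 481, 0), (17, 491521, 0), (24, 3618, 0), (25, 3702786, 0),
     (26, 234913824, 0), (32, 12868, 0), (33, 13172740, 0), (34, 838926400, 0),
     (35, 6476530176, 0), (40, 21640, 0), (41, 22151176, 0), (42, 1409417344, 0),
     (43, 10805576704, 0), (44, 19599986688, 0), (48, 26896, 0), (49, 27525136, 0),
     (50, 1745092864, 0), (51, 13021218816, 0), (52, 22020104192, 0), (53, 26860339200, 0)]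

/-- The code of the arc from `i` to `j`, where directions are ignored unless `o` is set. -/
def codeArc (o : Bool) (i j : ℕ) : ℕ × Bool :=
  if i < j then (8 * j + i, false) else (8 * i + j, o)

/-- The `i`-th binary digit of `m`. -/
def bit (m i : ℕ) : Bool := Nat.beq (Nat.land (Nat.shiftRight m i) 1) 1

/-- The targets of the complete board containing the arc `a`. -/
def targetsOn (a : ℕ × Bool) : List (ℕ × ℕ × ℕ) → ℕ
  | [] => 0
  | q :: es => bif Nat.beq q.1 a.1 then bif a.2 then q.2.2 else q.2.1 else targetsOn a es

/-- The number of a target of the complete board containing the cyclic triangle `i`, `j`, `k`. -/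
def targetNumber (o : Bool) (i j k : ℕ) : ℕ :=
  Nat.log2 (Nat.land (targetsOn (codeArc o i j) (completeBoard o))
    (Nat.land (targetsOn (codeArc o j k) (completeBoard o))
      (targetsOn (codeArc o k i) (completeBoard o))))

/-- The edges of the board of the graph coded by `G`. -/
def boardEdges (G : ℕ) : List (ℕ × ℕ × ℕ) → List (ℕ × ℕ × ℕ)
  | [] => []
  | q :: es => bif bit G q.1 then q :: boardEdges G es else boardEdges G es

/-- The targets among the first `N` targets all of whose edges belong to the graph coded by `G`. -/
def boardTargets (G N : ℕ) : List (ℕ × ℕ × ℕ) → ℕ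
  | [] => 2 ^ N - 1
  | q :: es => bif bit G q.1 then boardTargets G N es
      else maskDiff (boardTargets G N es) (Nat.lor q.2.1 q.2.2)

/-- The number of targets of the complete board. -/
def targetCount (o : Bool) : ℕ := bif o then 70 else 35

/-- The test for Breaker surviving on the graph coded by `G`. -/
def survivesGraph (o : Bool) (fuel G : ℕ) : Bool :=
  survivesCode fuel (boardEdges G (completeBoard o))
    (boardTargets G (targetCount o) (completeBoard o))

theorem bit_eq (m i : ℕ) : bit m i = m.testBit i := by
  unfold bit
  rw [Bool.eq_iff_iff, Nat.testBit_eq_decide_div_mod_eq, decide_eq_true_iff, Nat.beq_eq]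
  change (m >>> i) &&& 1 = 1 ↔ _
  rw [Nat.and_one_is_mod, Nat.shiftRight_eq_div_pow]

theorem completeBoard_nodup (o : Bool) : ((completeBoard o).map Prod.fst).Nodup := by
  cases o <;> decide +kernel

/-- Whether a target of the complete board is contained in the cyclic triangle `i`, `j`, `k`. -/
def coversTriangle (o : Bool) (i j k : ℕ) : Bool :=
  decide (targetNumber o i j k < targetCount o) && (completeBoard o).all fun q =>
    (!bit q.2.1 (targetNumber o i j k) ||
      decide ((q.1, false) ∈ [codeArc o i j, codeArc o j k, codeArc o k i])) &&
    (!bit q.2.2 (targetNumber o i j k) ||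
      decide ((q.1, true) ∈ [codeArc o i j, codeArc o j k, codeArc o k i]))

theorem coversTriangle_eq_true (o : Bool) : ∀ i ∈ List.range 7, ∀ j ∈ List.range 7,
    ∀ k ∈ List.range 7, (i = j ∨ j = k ∨ i = k) ∨ coversTriangle o i j k = true := by
  cases o <;> decide +kernel

theorem completeBoard_covers (o : Bool) {i j k : ℕ} (hi : i < 7) (hj : j < 7) (hk : k < 7)
    (hij : i ≠ j) (hjk : j ≠ k) (hik : i ≠ k) :
    targetNumber o i j k < targetCount o ∧ ∀ q ∈ completeBoard o,
      (q.2.1.testBit (targetNumber o i j k) = true →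
        (q.1, false) ∈ [codeArc o i j, codeArc o j k, codeArc o k i]) ∧
      (q.2.2.testBit (targetNumber o i j k) = true →
        (q.1, true) ∈ [codeArc o i j, codeArc o j k, codeArc o k i]) := by
  have h := (coversTriangle_eq_true o i (List.mem_range.2 hi) j (List.mem_range.2 hj)
    k (List.mem_range.2 hk)).resolve_left (by tauto)
  unfold coversTriangle at h
  rw [Bool.and_eq_true, decide_eq_true_iff, List.all_eq_true] at h
  refine ⟨h.1, fun q hq => ?_⟩
  have h := h.2 q hq
  rw [Bool.and_eq_true, bit_eq, bit_eq, Bool.or_eq_true, Bool.or_eq_true, decide_eq_true_iff,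
    decide_eq_true_iff] at h
  exact ⟨fun hb => h.1.resolve_left (by simp [hb]), fun hb => h.2.resolve_left (by simp [hb])⟩

theorem mem_boardEdges {G : ℕ} {es : List (ℕ × ℕ × ℕ)} {q : ℕ × ℕ × ℕ} :
    q ∈ boardEdges G es ↔ q ∈ es ∧ G.testBit q.1 = true := by
  induction es with
  | nil => simp [boardEdges]
  | cons r es ih =>
    rw [boardEdges, bit_eq]
    cases hc : G.testBit r.1 with
    | true => rw [cond_true, List.mem_cons, ih, List.mem_cons]; grind
    | false => rw [cond_false, ih, List.mem_cons]; grind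

theorem boardEdges_sublist (G : ℕ) (es : List (ℕ × ℕ × ℕ)) : (boardEdges G es).Sublist es := by
  induction es with
  | nil => exact List.Sublist.refl _
  | cons r es ih =>
    rw [boardEdges]
    cases bit G r.1 with
    | true => exact ih.cons_cons _
    | false => exact ih.cons _

theorem testBit_boardTargets {G N t : ℕ} (ht : t < N) {es : List (ℕ × ℕ × ℕ)}
    (h : ∀ q ∈ es, (q.2.1.testBit t || q.2.2.testBit t) = true → G.testBit q.1 = true) :
    (boardTargets G N es).testBit t = true := by
  induction es with
  | nil => rw [boardTargets, Nat.testBit_two_pow_sub_one]; simpa using ht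
  | cons q es ih =>
    rw [boardTargets, bit_eq]
    have ih := ih fun q hq => h q (List.mem_cons_of_mem _ hq)
    cases hc : G.testBit q.1 with
    | true => exact ih
    | false =>
      rw [cond_false, testBit_maskDiff, ih]
      change (true && !(q.2.1 ||| q.2.2).testBit t) = true
      rw [Nat.testBit_or]
      have := h q List.mem_cons_self
      cases hb : q.2.1.testBit t || q.2.2.testBit t with
      | true => exact absurd (hc.symm.trans (this hb)) Bool.false_ne_true
      | false => rfl

theorem codeArc_fst_inj {o : Bool} {i j k l : ℕ} (hi : i < 7) (hj : j < 7) (hk : k < 7) (hl : l < 7)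
    (h : (codeArc o i j).1 = (codeArc o k l).1) : i = k ∧ j = l ∨ i = l ∧ j = k := by
  unfold codeArc at h
  split_ifs at h <;> dsimp only at h <;> omega

section Boards

variable {V : Type*} [DecidableEq V] {X : Finset (Sym2 V)} {v : ℕ → V}

/-- `G` codes the subgraph of `X` induced by `v 0, …, v (k - 1)`. -/
def IsGraphCode (X : Finset (Sym2 V)) (v : ℕ → V) (k G : ℕ) : Prop :=
  ∀ j, ∀ i < 8, G.testBit (8 * j + i) = true ↔ i < j ∧ j < k ∧ s(v i, v j) ∈ X

theorem survives_of_isGraphCode {n : ℕ} (hn : n ≤ 7) (hv : Set.InjOn v (Set.Iio n))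
    (hV : ∀ x y, s(x, y) ∈ X → ∃ i < n, v i = x) {G : ℕ}
    (hG : IsGraphCode X v n G) (o : Bool) {fuel : ℕ}
    (h : survivesGraph o fuel G = true)
    (m : ℕ) : Survives arcEdge m (cyclicTriangles X) := by
  classical
  let g : V → ℕ := fun x => if hx : ∃ i < n, v i = x then hx.choose else 0
  have hg : ∀ i < n, g (v i) = i := by
    intro i hi
    have hx : ∃ j < n, v j = v i := ⟨i, hi, rfl⟩
    have : g (v i) = hx.choose := dif_pos hx
    rw [this]
    exact hv hx.choose_spec.1 hi hx.choose_spec.2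
  have hV' : ∀ x y, s(x, y) ∈ X → ∃ i < n, v i = y := fun x y hxy => hV y x (Sym2.eq_swap ▸ hxy)
  refine (survives_of_survivesCode ((completeBoard_nodup o).sublist
      ((boardEdges_sublist G _).map _)) h m).comap
    (fun a => codeArc o (g a.1) (g a.2)) {a | (∃ i < n, v i = a.1) ∧ ∃ i < n, v i = a.2} ?_ ?_
  · rintro ⟨x, y⟩ ⟨⟨i, hi, rfl⟩, j, hj, rfl⟩ ⟨z, w⟩ ⟨⟨k, hk, rfl⟩, l, hl, rfl⟩ he
    change (codeArc o (g (v i)) (g (v j))).1 = (codeArc o (g (v k)) (g (v l))).1 at he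
    rw [hg i hi, hg j hj, hg k hk, hg l hl] at he
    rcases codeArc_fst_inj (by omega) (by omega) (by omega) (by omega) he with
      ⟨rfl, rfl⟩ | ⟨rfl, rfl⟩
    · rfl
    · exact Sym2.eq_swap
  · rintro H ⟨x, y, z, hxy, hyz, hxz, h1, h2, h3, rfl⟩
    refine ⟨?_, ?_⟩
    · rintro a (rfl | rfl | rfl)
      · exact ⟨hV _ _ h1, hV' _ _ h1⟩
      · exact ⟨hV _ _ h2, hV' _ _ h2⟩
      · exact ⟨hV _ _ h3, hV' _ _ h3⟩
    obtain ⟨i, hi, rfl⟩ := hV _ _ h1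
    obtain ⟨j, hj, rfl⟩ := hV _ _ h2
    obtain ⟨k, hk, rfl⟩ := hV _ _ h3
    have hij : i ≠ j := fun h => hxy (h ▸ rfl)
    have hjk : j ≠ k := fun h => hyz (h ▸ rfl)
    have hik : i ≠ k := fun h => hxz (h ▸ rfl)
    have hbit : ∀ i < n, ∀ j < n, i ≠ j → s(v i, v j) ∈ X →
        G.testBit (codeArc o i j).1 = true := by
      intro i hi j hj hij hX
      unfold codeArc
      split_ifs with hlt
      · exact (hG j i (by omega)).2 ⟨hlt, hj, hX⟩
      · exact (hG i j (by omega)).2 ⟨by omega, hi, Sym2.eq_swap ▸ hX⟩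
    obtain ⟨ht, hq⟩ := completeBoard_covers o (i := i) (j := j) (k := k) (by omega) (by omega) (by omega) hij hjk hik
    simp only [List.mem_cons, List.not_mem_nil, or_false] at hq
    refine ⟨_, ⟨targetNumber o i j k, testBit_boardTargets ht fun q hqm hb => ?_, rfl⟩, ?_⟩
    · have : q.1 = (codeArc o i j).1 ∨ q.1 = (codeArc o j k).1 ∨ q.1 = (codeArc o k i).1 := by
        rw [Bool.or_eq_true] at hb
        rcases hb with hb | hb
        · rcases (hq q hqm).1 hb with h | h | h <;> rw [← h] <;> simp
        · rcases (hq q hqm).2 hb with h | h | h <;> rw [← h] <;> simp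
      rcases this with h | h | h <;> rw [h]
      · exact hbit i hi j hj hij h1
      · exact hbit j hj k hk hjk h2
      · exact hbit k hk i hi hik.symm h3
    · rintro ⟨e, b⟩ ⟨q, hqm, rfl, hb⟩
      have hmem : (q.1, b) = codeArc o i j ∨ (q.1, b) = codeArc o j k ∨
          (q.1, b) = codeArc o k i := by
        cases b
        · exact (hq q (mem_boardEdges.1 hqm).1).1 hb
        · exact (hq q (mem_boardEdges.1 hqm).1).2 hb
      rcases hmem with hm | hm | hm
      · exact ⟨(v i, v j), by simp [cyclicArcs], by simp [hg, hi, hj, hm]⟩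
      · exact ⟨(v j, v k), by simp [cyclicArcs], by simp [hg, hk, hj, hm]⟩
      · exact ⟨(v k, v i), by simp [cyclicArcs], by simp [hg, hi, hk, hm]⟩

end Boards

/-- The number of `i < n` with `p i`. -/
def countBelow : ℕ → (ℕ → Bool) → ℕ
  | 0, _ => 0
  | n + 1, p => bif p n then Nat.succ (countBelow n p) else countBelow n p

/-- Whether `i` and `j` are adjacent in the graph coded by `G`. -/
def adjBit (G i j : ℕ) : Bool :=
  bit G (Nat.add (Nat.mul 8 j) i) || bit G (Nat.add (Nat.mul 8 i) j)

/-- Whether the set coded by `r` contains an edge of the graph coded by `G`. -/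
def spansEdge (k r G : ℕ) : Bool :=
  (List.range k).any fun i => bit r i &&
    !Nat.beq (Nat.land (Nat.shiftRight G (Nat.mul 8 i)) r) 0

/-- Whether the set coded by `r` contains no triangle of the graph coded by `G`. -/
def spansNoTriangle (k r G : ℕ) : Bool :=
  (List.range k).all fun i => !bit r i || (List.range i).all fun j =>
    !bit (Nat.land (Nat.shiftRight G (Nat.mul 8 i)) r) j ||
    Nat.beq (Nat.land (Nat.land (Nat.shiftRight G (Nat.mul 8 i)) r)
      (Nat.shiftRight G (Nat.mul 8 j))) 0

/-- If the graph on `{0, …, n - 1}` coded by `G` has minimum degree at least `3` and every edge in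
a triangle, then Breaker survives on it. -/
def leafCheck (o : Bool) (fuel n G : ℕ) : Bool :=
  !((List.range n).all (fun i => Nat.ble 3 (countBelow n (adjBit G i))) &&
    (List.range n).all fun i => (List.range i).all fun j =>
      !bit G (Nat.add (Nat.mul 8 i) j) || (List.range n).any fun l => adjBit G i l && adjBit G j l) ||
  survivesGraph o fuel G

/-- Check `leaf` for all extensions of the graph on `{0, …, k - 1}` coded by `G` by `m` vertices of
total degree `2 * m + b`. -/
def explore (noK4 : Bool) (leaf : ℕ → Bool) : ℕ → ℕ → ℕ → ℕ → Bool
  | 0, _, b, G => !Nat.beq b 0 || leaf G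
  | m + 1, k, b, G => Nat.beq b 0 || (List.range (2 ^ k)).all fun r =>
      !(Nat.ble 2 (countBelow k (bit r)) && (Nat.ble (countBelow k (bit r)) (b + 2) &&
        (spansEdge k r G && (!noK4 || spansNoTriangle k r G)))) ||
      explore noK4 leaf m (k + 1) (Nat.sub (Nat.add b 2) (countBelow k (bit r)))
        (Nat.lor G (Nat.shiftLeft r (Nat.mul 8 k)))

theorem countBelow_eq (n : ℕ) (p : ℕ → Bool) :
    countBelow n p = ((Finset.range n).filter fun i => p i = true).card := by
  induction n with
  | zero => rfl
  | succ n ih =>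
    rw [countBelow, Finset.range_add_one, Finset.filter_insert]
    cases hp : p n with
    | true =>
      rw [cond_true, if_pos rfl, Finset.card_insert_of_notMem (by simp), ih]
    | false =>
      rw [cond_false, if_neg Bool.false_ne_true, ih]

section Boards

variable {V : Type*} [DecidableEq V] {X : Finset (Sym2 V)} {v : ℕ → V}

theorem IsGraphCode.adjBit {n G : ℕ} (hG : IsGraphCode X v n G) (hn : n ≤ 7)
    (hX : ∀ x, s(x, x) ∉ X) {i j : ℕ} (hi : i < n) (hj : j < n) :
    adjBit G i j = true ↔ s(v i, v j) ∈ X := by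
  unfold TournamentGame.adjBit
  rw [Bool.or_eq_true, bit_eq, bit_eq]
  change G.testBit (8 * j + i) = true ∨ G.testBit (8 * i + j) = true ↔ _
  rw [hG j i (by omega), hG i j (by omega), Sym2.eq_swap (a := v j)]
  rcases lt_trichotomy i j with h | rfl | h
  · simp [h, hj, h.le]
  · simp [hX]
  · simp [h, hi, h.le]

/-- The number of neighbours of `v j` among `v 0, …, v (j - 1)`. -/
def backDegree (X : Finset (Sym2 V)) (v : ℕ → V) (j : ℕ) : ℕ :=
  ((Finset.range j).filter fun i => s(v i, v j) ∈ X).card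

theorem survives_of_leafCheck {n : ℕ} (hn : n ≤ 7) (hv : Set.InjOn v (Set.Iio n))
    (hX : ∀ x, s(x, x) ∉ X) (hV : ∀ x y, s(x, y) ∈ X → ∃ i < n, v i = x)
    (hdeg : ∀ i < n, 3 ≤ ((Finset.range n).filter fun j => s(v i, v j) ∈ X).card)
    (htri : ∀ x y, s(x, y) ∈ X → ∃ z, s(x, z) ∈ X ∧ s(y, z) ∈ X) {G : ℕ}
    (hG : IsGraphCode X v n G) {o : Bool} {fuel : ℕ} (h : leafCheck o fuel n G = true) (m : ℕ) :
    Survives arcEdge m (cyclicTriangles X) := by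
  refine survives_of_isGraphCode hn hv hV hG o (fuel := fuel) ?_ m
  unfold leafCheck at h
  rw [Bool.or_eq_true] at h
  refine h.resolve_left ?_
  rw [Bool.not_eq_true', Bool.not_eq_false, Bool.and_eq_true, List.all_eq_true, List.all_eq_true]
  constructor
  · intro i hi
    rw [List.mem_range] at hi
    refine Nat.ble_eq_true_of_le ((hdeg i hi).trans_eq ?_)
    rw [countBelow_eq]
    congr 1
    refine Finset.filter_congr fun j hj => ?_
    rw [hG.adjBit hn hX hi (Finset.mem_range.1 hj)]
  · intro i hi
    rw [List.all_eq_true]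
    intro j hj
    rw [List.mem_range] at hi hj
    rw [Bool.or_eq_true, Bool.not_eq_true', bit_eq, or_iff_not_imp_left, Bool.not_eq_false]
    intro hb
    obtain ⟨-, -, hb⟩ := (hG i j (by omega)).1 hb
    obtain ⟨z, hz1, hz2⟩ := htri _ _ hb
    obtain ⟨l, hl, rfl⟩ := hV z (v j) (Sym2.eq_swap ▸ hz1)
    rw [List.any_eq_true]
    refine ⟨l, List.mem_range.2 hl, ?_⟩
    rw [Bool.and_eq_true, hG.adjBit hn hX hi hl, hG.adjBit hn hX (hj.trans hi) hl]
    exact ⟨hz2, hz1⟩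

theorem IsGraphCode.extend {k G r : ℕ} (hG : IsGraphCode X v k G) (hk : k < 7)
    (hr : ∀ i, r.testBit i = true ↔ i < k ∧ s(v i, v k) ∈ X) :
    IsGraphCode X v (k + 1) (Nat.lor G (Nat.shiftLeft r (Nat.mul 8 k))) := by
  intro j i hi
  change (G ||| r <<< (8 * k)).testBit (8 * j + i) = true ↔ _
  rw [Nat.testBit_or, Bool.or_eq_true, hG j i hi, Nat.testBit_shiftLeft, Bool.and_eq_true,
    decide_eq_true_iff, hr]
  rcases lt_trichotomy j k with h | rfl | h
  · have h1 : ¬ 8 * j + i ≥ 8 * k := by omega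
    simp [h1, h, h.trans (Nat.lt_succ_self k)]
  · have h2 : 8 * j + i - 8 * j = i := by omega
    rw [h2]
    simp
  · have h1 : ¬ 8 * j + i - 8 * k < k := by omega
    simp [h1, h.not_gt]
    omega

theorem survives_of_explore {n : ℕ} (hn : n ≤ 7) (hv : Set.InjOn v (Set.Iio n))
    (hX : ∀ x, s(x, x) ∉ X) (hV : ∀ x y, s(x, y) ∈ X → ∃ i < n, v i = x)
    (hdeg : ∀ i < n, 3 ≤ ((Finset.range n).filter fun j => s(v i, v j) ∈ X).card)
    (htri : ∀ x y, s(x, y) ∈ X → ∃ z, s(x, z) ∈ X ∧ s(y, z) ∈ X) {noK4 : Bool}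
    (hK : noK4 = true → ∀ a b c d, ¬(s(a, b) ∈ X ∧ s(a, c) ∈ X ∧ s(a, d) ∈ X ∧ s(b, c) ∈ X ∧
      s(b, d) ∈ X ∧ s(c, d) ∈ X)) {o : Bool} {fuel : ℕ} {m : ℕ} :
    ∀ {k b G : ℕ}, k + m = n → (∀ j, k ≤ j → j < n → ∃ p q, p < q ∧ q < j ∧
      s(v p, v q) ∈ X ∧ s(v p, v j) ∈ X ∧ s(v q, v j) ∈ X) →
    ∑ j ∈ Finset.Ico k n, backDegree X v j = b + 2 * m →
    IsGraphCode X v k G → explore noK4 (leafCheck o fuel n) m k b G = true → ∀ t,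
      Survives arcEdge t (cyclicTriangles X) := by
  induction m with
  | zero =>
    intro k b G hk hgrow hsum hG h t
    obtain rfl : k = n := hk
    rw [Finset.Ico_self, Finset.sum_empty] at hsum
    obtain rfl : b = 0 := by omega
    exact survives_of_leafCheck hn hv hX hV hdeg htri hG h t
  | succ m ih =>
    intro k b G hk hgrow hsum hG h t
    have htwo : ∀ j, k ≤ j → j < n → 2 ≤ backDegree X v j := by
      intro j hkj hj
      obtain ⟨p, q, hpq, hqj, -, hp, hq⟩ := hgrow j hkj hj
      have : ({p, q} : Finset ℕ) ⊆ (Finset.range j).filter fun i => s(v i, v j) ∈ X := by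
        intro i hi
        rw [Finset.mem_insert, Finset.mem_singleton] at hi
        rw [Finset.mem_filter, Finset.mem_range]
        rcases hi with rfl | rfl
        · exact ⟨hpq.trans hqj, hp⟩
        · exact ⟨hqj, hq⟩
      exact (Finset.card_pair hpq.ne).symm.le.trans (Finset.card_le_card this)
    have hlast : 3 ≤ backDegree X v (n - 1) := by
      refine (hdeg (n - 1) (by omega)).trans (Finset.card_le_card fun i hi => ?_)
      rw [Finset.mem_filter, Finset.mem_range] at hi ⊢
      refine ⟨?_, Sym2.eq_swap ▸ hi.2⟩
      have : i ≠ n - 1 := by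
        rintro rfl
        exact hX _ hi.2
      omega
    have hsplit : ∑ j ∈ Finset.Ico k n, backDegree X v j =
        backDegree X v k + ∑ j ∈ Finset.Ico (k + 1) n, backDegree X v j :=
      Finset.sum_eq_sum_Ico_succ_bot (by omega) _
    have hrest : 2 * m ≤ ∑ j ∈ Finset.Ico (k + 1) n, backDegree X v j := by
      have : (Finset.Ico (k + 1) n).card • 2 ≤ ∑ j ∈ Finset.Ico (k + 1) n, backDegree X v j :=
        Finset.card_nsmul_le_sum _ _ 2 fun j hj =>
          htwo j (by have := (Finset.mem_Ico.1 hj).1; omega) (Finset.mem_Ico.1 hj).2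
      rw [Nat.card_Ico, smul_eq_mul] at this
      omega
    have hb : b ≠ 0 := by
      have : 2 * (m + 1) < ∑ j ∈ Finset.Ico k n, backDegree X v j := by
        have hlt : ∑ j ∈ Finset.Ico k n, 2 < ∑ j ∈ Finset.Ico k n, backDegree X v j :=
          Finset.sum_lt_sum (fun j hj => htwo j (Finset.mem_Ico.1 hj).1 (Finset.mem_Ico.1 hj).2)
            ⟨n - 1, Finset.mem_Ico.2 ⟨by omega, by omega⟩, hlast⟩
        rw [Finset.sum_const, Nat.card_Ico, smul_eq_mul] at hlt
        omega
      omega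
    rw [explore, Bool.or_eq_true] at h
    replace h := h.resolve_left fun h => hb (Nat.eq_of_beq_eq_true h)
    rw [List.all_eq_true] at h
    obtain ⟨r, hrlt, hr⟩ : ∃ r < 2 ^ k, ∀ i, r.testBit i = true ↔ i < k ∧ s(v i, v k) ∈ X := by
      refine ⟨Nat.ofBits fun i : Fin k => decide (s(v i, v k) ∈ X), Nat.ofBits_lt_two_pow _, ?_⟩
      intro i
      by_cases hi : i < k
      · rw [Nat.testBit_ofBits_lt _ i hi]
        simp [hi]
      · rw [Nat.testBit_ofBits_ge _ i (by omega)]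
        simp [hi]
    have hcount : countBelow k (bit r) = backDegree X v k := by
      rw [countBelow_eq, backDegree]
      congr 1
      refine Finset.filter_congr fun i hi => ?_
      rw [bit_eq, hr, and_iff_right (Finset.mem_range.1 hi)]
    have hrow : ∀ i < k, ∀ j, (Nat.land (Nat.shiftRight G (Nat.mul 8 i)) r).testBit j = true ↔
        j < i ∧ s(v j, v i) ∈ X ∧ s(v j, v k) ∈ X := by
      intro i hi j
      change ((G >>> (8 * i)) &&& r).testBit j = true ↔ _
      rw [Nat.testBit_and, Bool.and_eq_true, Nat.testBit_shiftRight, hr]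
      by_cases hj : j < k
      · rw [hG i j (by omega)]
        simp only [hj, hi, true_and, and_assoc]
      · have : ¬ j < i := by omega
        simp [hj, this]
    have hr' := h r (List.mem_range.2 hrlt)
    rw [Bool.or_eq_true, hcount] at hr'
    refine ih (by omega) (fun j hj => hgrow j (by omega)) ?_ (hG.extend (by omega) hr)
      (hr'.resolve_left ?_) t
    · change _ = b + 2 - backDegree X v k + 2 * m
      omega
    · rw [Bool.not_eq_true', Bool.not_eq_false, Bool.and_eq_true, Bool.and_eq_true,
        Bool.and_eq_true, Bool.or_eq_true]
      refine ⟨Nat.ble_eq_true_of_le (htwo k le_rfl (by omega)),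
        Nat.ble_eq_true_of_le (by omega), ?_, ?_⟩
      · obtain ⟨p, q, hpq, hqk, hXpq, hXp, hXq⟩ := hgrow k le_rfl (by omega)
        rw [spansEdge, List.any_eq_true]
        refine ⟨q, List.mem_range.2 hqk, ?_⟩
        rw [Bool.and_eq_true, bit_eq, Bool.not_eq_true']
        refine ⟨(hr q).2 ⟨hqk, hXq⟩, ?_⟩
        rw [← Bool.not_eq_true]
        intro h0
        have := (hrow q hqk p).2 ⟨hpq, hXpq, hXp⟩
        rw [Nat.eq_of_beq_eq_true h0, Nat.zero_testBit] at this
        exact Bool.false_ne_true this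
      · rw [or_iff_not_imp_left, Bool.not_eq_true', Bool.not_eq_false]
        intro hno
        rw [spansNoTriangle, List.all_eq_true]
        intro i hi
        rw [List.mem_range] at hi
        rw [Bool.or_eq_true, or_iff_not_imp_left, Bool.not_eq_true', Bool.not_eq_false,
          List.all_eq_true, bit_eq, hr]
        rintro ⟨-, hik⟩ j hj
        rw [List.mem_range] at hj
        rw [Bool.or_eq_true, or_iff_not_imp_left, Bool.not_eq_true', Bool.not_eq_false, bit_eq,
          hrow i hi]
        rintro ⟨-, hji, hjk⟩
        rw [Nat.beq_eq]
        by_contra h0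
        obtain ⟨l, hl⟩ := Nat.exists_testBit_of_ne_zero h0
        change (Nat.land (Nat.shiftRight G (Nat.mul 8 i)) r &&& (G >>> (8 * j))).testBit l = true
          at hl
        rw [Nat.testBit_and, Bool.and_eq_true, hrow i hi, Nat.testBit_shiftRight] at hl
        obtain ⟨⟨hli, hXli, hXlk⟩, hlj⟩ := hl
        rw [hG j l (by omega)] at hlj
        exact hK hno _ _ _ _ ⟨hlj.2.2, hXli, hXlk, hji, hjk, hik⟩

end Boards

theorem explore_four : explore false (leafCheck true 3 4) 0 4 0 117637376 = true := by
  decide +kernel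
theorem explore_five : explore false (leafCheck true 3 5) 1 4 1 117637376 = true := by
  decide +kernel
theorem explore_six : explore false (leafCheck true 3 6) 1 5 1 13002539264 = true := by
  decide +kernel
theorem explore_seven : explore false (leafCheck true 3 7) 2 5 1 13002539264 = true := by
  decide +kernel
theorem explore_diamond_five : explore true (leafCheck false 1 5) 1 4 2 50528512 = true := by
  decide +kernel
theorem explore_diamond_six : explore true (leafCheck false 1 6) 2 4 2 50528512 = true := by
  decide +kernel
theorem explore_diamond_seven : explore true (leafCheck false 1 7) 3 4 2 50528512 = true := by
  decide +kernel

section Reductions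

variable {V : Type*} [DecidableEq V] {X : Finset (Sym2 V)} {t : ℕ}

theorem mem_cyclicTriangles_cases {H : Set (V × V)} (hH : H ∈ cyclicTriangles X) (u : V) :
    H ∈ cyclicTriangles (X.filter (u ∉ ·)) ∨ ∃ y z, u ≠ y ∧ u ≠ z ∧ y ≠ z ∧ s(u, y) ∈ X ∧
      s(u, z) ∈ X ∧ s(y, z) ∈ X ∧ H = cyclicArcs u y z := by
  obtain ⟨x, y, z, h1, h2, h3, h4, h5, h6, rfl⟩ := hH
  by_cases hx : u = x
  · subst hx
    exact .inr ⟨y, z, h1, h3, h2, h4, Sym2.eq_swap ▸ h6, h5, rfl⟩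
  by_cases hy : u = y
  · subst hy
    exact .inr ⟨z, x, h2, h1.symm, h3.symm, h5, Sym2.eq_swap ▸ h4, h6, cyclicArcs_rotate _ _ _⟩
  by_cases hz : u = z
  · subst hz
    exact .inr ⟨x, y, h3.symm, h2.symm, h1, h6, Sym2.eq_swap ▸ h5, h4,
      (cyclicArcs_rotate _ _ _).symm⟩
  · refine .inl ⟨x, y, z, h1, h2, h3, ?_, ?_, ?_, rfl⟩ <;>
      simp [h4, h5, h6, hx, hy, hz]

/-- `cyclicArcs u y z` has an arc over each of its edges. -/
theorem exists_arc_of_edge {u y z : V} {e : Sym2 V}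
    (he : e = s(u, y) ∨ e = s(u, z) ∨ e = s(y, z)) : ∃ a ∈ cyclicArcs u y z, arcEdge a = e := by
  rcases he with rfl | rfl | rfl
  · exact ⟨(u, y), by simp [cyclicArcs], rfl⟩
  · exact ⟨(z, u), by simp [cyclicArcs], Sym2.eq_swap⟩
  · exact ⟨(y, z), by simp [cyclicArcs], rfl⟩

theorem arcEdge_of_mem_cyclicArcs {u y z : V} {a : V × V} (ha : a ∈ cyclicArcs u y z) :
    arcEdge a = s(u, y) ∨ arcEdge a = s(u, z) ∨ arcEdge a = s(y, z) := by
  rcases ha with rfl | rfl | rfl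
  · exact .inl rfl
  · exact .inr (.inr rfl)
  · exact .inr (.inl Sym2.eq_swap)

theorem survives_of_closed {S : Finset V}
    (hS : ∀ p q u, p ∈ S → q ∈ S → s(p, q) ∈ X → s(p, u) ∈ X → s(q, u) ∈ X → u ∈ S)
    (h1 : Survives arcEdge t (cyclicTriangles (X ∩ S.sym2)))
    (h2 : Survives arcEdge t (cyclicTriangles (X \ S.sym2))) :
    Survives arcEdge t (cyclicTriangles X) := by
  refine (h1.union h2 ?_).mono ?_
  · intro G hG H hH a ha b hb hab
    have ha' := arcEdge_mem_of_mem_cyclicTriangles hG ha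
    have hb' := arcEdge_mem_of_mem_cyclicTriangles hH hb
    rw [← hab] at hb'
    exact (Finset.mem_sdiff.1 hb').2 (Finset.mem_inter.1 ha').2
  · rintro H ⟨x, y, z, h1, h2, h3, h4, h5, h6, rfl⟩
    refine ⟨cyclicArcs x y z, ?_, subset_rfl⟩
    have hall : (x ∈ S ∧ y ∈ S) ∨ (y ∈ S ∧ z ∈ S) ∨ (z ∈ S ∧ x ∈ S) → x ∈ S ∧ y ∈ S ∧ z ∈ S := by
      rintro (⟨h, h'⟩ | ⟨h, h'⟩ | ⟨h, h'⟩)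
      · exact ⟨h, h', hS x y z h h' h4 (Sym2.eq_swap ▸ h6) h5⟩
      · exact ⟨hS y z x h h' h5 (Sym2.eq_swap ▸ h4) h6, h, h'⟩
      · exact ⟨h', hS z x y h h' h6 (Sym2.eq_swap ▸ h5) h4, h⟩
    by_cases hin : (x ∈ S ∧ y ∈ S) ∨ (y ∈ S ∧ z ∈ S) ∨ (z ∈ S ∧ x ∈ S)
    · obtain ⟨hx, hy, hz⟩ := hall hin
      refine .inl ⟨x, y, z, h1, h2, h3, ?_, ?_, ?_, rfl⟩ <;>
        simp only [Finset.mem_inter, Finset.mk_mem_sym2_iff] <;> tauto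
    · refine .inr ⟨x, y, z, h1, h2, h3, ?_, ?_, ?_, rfl⟩ <;>
        simp only [Finset.mem_sdiff, Finset.mk_mem_sym2_iff] <;> tauto

theorem survives_of_degree_le_two (hX : ∀ x, s(x, x) ∉ X) {u w : V} (hw : s(u, w) ∈ X) {N : Finset V}
    (hN : ∀ w, s(u, w) ∈ X → w ∈ N) (hcard : N.card ≤ 2)
    (h : Survives arcEdge t (cyclicTriangles (X.filter (u ∉ ·)))) :
    Survives arcEdge t (cyclicTriangles X) := by
  obtain ⟨a, b, hab, hN⟩ : ∃ a b, s(u, a) ≠ s(u, b) ∧ ∀ w, s(u, w) ∈ X → w = a ∨ w = b := by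
    obtain ⟨a, b, hNab⟩ : ∃ a b, N ⊆ {a, b} := by
      rcases Nat.lt_or_ge N.card 2 with h | h
      · have : Nonempty V := ⟨u⟩
        obtain ⟨a, ha⟩ := Finset.card_le_one_iff_subset_singleton.1 (Nat.le_of_lt_succ h)
        exact ⟨a, a, by simpa using ha⟩
      · obtain ⟨a, b, -, rfl⟩ := Finset.card_eq_two.1 (le_antisymm hcard h)
        exact ⟨a, b, subset_rfl⟩
    have hN' : ∀ w, s(u, w) ∈ X → w = a ∨ w = b := fun w hw => by
      simpa using hNab (hN w hw)
    by_cases hab : a = b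
    · subst hab
      refine ⟨a, u, fun h => ?_, fun w hw => .inl (by simpa using hN' w hw)⟩
      obtain rfl : w = a := by simpa using hN' w hw
      exact hX _ (Sym2.congr_right.1 h ▸ hw)
    · exact ⟨a, b, fun h => hab (Sym2.congr_right.1 h), hN'⟩
  refine h.of_pair hab ?_ ?_
  · intro G hG c hc
    have := arcEdge_mem_of_mem_cyclicTriangles hG hc
    have := (Finset.mem_filter.1 this).2
    constructor <;> rintro heq <;> rw [heq] at this <;> simp at this
  · intro H hH
    rcases mem_cyclicTriangles_cases hH u with hH | ⟨y, z, -, -, hyz, hy, hz, -, rfl⟩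
    · exact .inl ⟨H, hH, subset_rfl⟩
    · refine .inr ⟨exists_arc_of_edge ?_, exists_arc_of_edge ?_⟩
      · rcases hN y hy with rfl | rfl <;> rcases hN z hz with rfl | rfl <;> simp_all
      · rcases hN y hy with rfl | rfl <;> rcases hN z hz with rfl | rfl <;> simp_all

theorem survives_of_not_in_triangle {x y : V}
    (hxy : ∀ z, s(x, z) ∈ X → s(y, z) ∉ X)
    (h : Survives arcEdge t (cyclicTriangles (X.erase s(x, y)))) :
    Survives arcEdge t (cyclicTriangles X) := by
  refine h.mono ?_
  rintro H ⟨a, b, c, h1, h2, h3, h4, h5, h6, rfl⟩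
  refine ⟨_, ⟨a, b, c, h1, h2, h3, ?_, ?_, ?_, rfl⟩, subset_rfl⟩
  all_goals
    refine Finset.mem_erase.2 ⟨?_, by assumption⟩
    intro heq
    rcases Sym2.eq_iff.1 heq with ⟨rfl, rfl⟩ | ⟨rfl, rfl⟩
  · exact hxy c (Sym2.eq_swap ▸ h6) h5
  · exact hxy c h5 (Sym2.eq_swap ▸ h6)
  · exact hxy a (Sym2.eq_swap ▸ h4) h6
  · exact hxy a h6 (Sym2.eq_swap ▸ h4)
  · exact hxy b (Sym2.eq_swap ▸ h5) h4
  · exact hxy b h4 (Sym2.eq_swap ▸ h5)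

/-- The directed triangles on `X`, with the arcs over the edge `g` presented to Maker. -/
def trianglesGiven (X : Finset (Sym2 V)) (g : Sym2 V) : Set (Set (V × V)) :=
  {H' | ∃ H ∈ cyclicTriangles X, H' = {a ∈ H | arcEdge a ≠ g}}

/-- Graphs obtained from an edge by successively attaching vertices to both ends of an edge. -/
inductive TwoTree : Finset (Sym2 V) → Prop
  | edge {x y : V} (h : x ≠ y) : TwoTree {s(x, y)}
  | attach {Y : Finset (Sym2 V)} {u p q : V} (hY : TwoTree Y) (hpq : s(p, q) ∈ Y)
      (hu : ∀ w, s(u, w) ∉ Y) : TwoTree (insert s(u, p) (insert s(u, q) Y))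

theorem TwoTree.notMem_diag (h : TwoTree X) : ∀ x, s(x, x) ∉ X := by
  induction h with
  | edge h =>
    intro z hz
    simp only [Finset.mem_singleton, Sym2.eq_iff] at hz
    rcases hz with ⟨rfl, rfl⟩ | ⟨rfl, rfl⟩ <;> exact h rfl
  | @attach Y u p q hY hpq hu ih =>
    intro z hz
    simp only [Finset.mem_insert, Sym2.eq_iff] at hz
    rcases hz with (⟨rfl, rfl⟩ | ⟨rfl, rfl⟩) | (⟨rfl, rfl⟩ | ⟨rfl, rfl⟩) | hz
    · exact hu _ hpq
    · exact hu _ hpq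
    · exact hu _ (Sym2.eq_swap ▸ hpq)
    · exact hu _ (Sym2.eq_swap ▸ hpq)
    · exact ih z hz

theorem TwoTree.survives_trianglesGiven (h : TwoTree X) :
    ∀ g ∈ X, Survives arcEdge t (trianglesGiven X g) := by
  induction h with
  | @edge x y h =>
    intro g hg
    refine (survives_empty t).mono ?_
    rintro H' ⟨H, ⟨a, b, c, h1, h2, h3, h4, h5, h6, rfl⟩, rfl⟩
    rw [Finset.mem_singleton] at h4 h5
    exfalso
    rw [← h5, Sym2.eq_swap, Sym2.congr_right] at h4
    exact h3 h4
  | @attach Y u p q hY hpq hu ih =>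
    have hup : u ≠ p := by rintro rfl; exact hu _ hpq
    have huq : u ≠ q := by rintro rfl; exact hu _ (Sym2.eq_swap ▸ hpq)
    have hpq' : p ≠ q := by rintro rfl; exact hY.notMem_diag _ hpq
    have huY : ∀ e ∈ Y, u ∉ e := by
      rintro e he ⟨w, rfl⟩
      exact hu w he
    have hpqu : s(p, q) ≠ s(u, p) ∧ s(p, q) ≠ s(u, q) :=
      ⟨fun h => huY _ hpq (h ▸ Sym2.mem_mk_left _ _), fun h => huY _ hpq (h ▸ Sym2.mem_mk_left _ _)⟩
    have hupq : s(u, p) ≠ s(u, q) := fun h => hpq' (Sym2.congr_right.1 h)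
    have hcases : ∀ H ∈ cyclicTriangles (insert s(u, p) (insert s(u, q) Y)),
        H ∈ cyclicTriangles Y ∨ (∃ a ∈ H, arcEdge a = s(u, p)) ∧ (∃ a ∈ H, arcEdge a = s(u, q)) ∧
          ∃ a ∈ H, arcEdge a = s(p, q) := by
      intro H hH
      rcases mem_cyclicTriangles_cases hH u with hH | ⟨y, z, -, -, hyz, hy, hz, -, rfl⟩
      · refine .inl (cyclicTriangles_mono ?_ hH)
        intro e he
        rw [Finset.mem_filter, Finset.mem_insert, Finset.mem_insert] at he
        rcases he with ⟨rfl | rfl | he, he'⟩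
        · simp at he'
        · simp at he'
        · exact he
      · have hN : ∀ w, s(u, w) ∈ insert s(u, p) (insert s(u, q) Y) → w = p ∨ w = q := by
          intro w hw
          simpa only [Finset.mem_insert, hu, or_false, Sym2.congr_right] using hw
        refine .inr ⟨exists_arc_of_edge ?_, exists_arc_of_edge ?_, exists_arc_of_edge ?_⟩ <;>
        rcases hN y hy with rfl | rfl <;> rcases hN z hz with rfl | rfl <;>
          simp_all [Sym2.eq_swap]
    have hgiven : ∀ g', ∀ G ∈ trianglesGiven Y g', ∀ a ∈ G, arcEdge a ∈ Y ∧ arcEdge a ≠ g' := by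
      rintro g' G ⟨H, hH, rfl⟩ a ha
      exact ⟨arcEdge_mem_of_mem_cyclicTriangles hH ha.1, ha.2⟩
    have hbase : ∀ {e e'}, e ≠ e' → ∀ g g', g' ∈ Y →
        (∀ G ∈ trianglesGiven Y g', ∀ a ∈ G, arcEdge a ≠ e ∧ arcEdge a ≠ e') → (∀ f ∈ Y, f = g → f = g') → e ≠ g → e' ≠ g → (∀ H : Set (V × V),
        ((∃ a ∈ H, arcEdge a = s(u, p)) ∧ (∃ a ∈ H, arcEdge a = s(u, q)) ∧
          ∃ a ∈ H, arcEdge a = s(p, q)) → (∃ a ∈ H, arcEdge a = e) ∧ ∃ a ∈ H, arcEdge a = e') →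
        Survives arcEdge t (trianglesGiven (insert s(u, p) (insert s(u, q) Y)) g) := by
      intro e e' hee g g' hg' hd hgg heg heg' hHe
      refine (ih g' hg').of_pair hee hd ?_
      rintro H' ⟨H, hH, rfl⟩
      rcases hcases H hH with hH | hH
      · refine .inl ⟨_, ⟨H, hH, rfl⟩, fun a ha => ⟨ha.1, fun hag => ha.2 ?_⟩⟩
        exact hgg _ (arcEdge_mem_of_mem_cyclicTriangles hH ha.1) hag
      · obtain ⟨⟨a, ha, rfl⟩, b, hb, rfl⟩ := hHe H hH
        exact .inr ⟨⟨a, ⟨ha, heg⟩, rfl⟩, b, ⟨hb, heg'⟩, rfl⟩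
    have hYu : ∀ {w e}, e ∈ Y → e ≠ s(u, w) := fun {w e} he h => hu w (h ▸ he)
    intro g hg
    rw [Finset.mem_insert, Finset.mem_insert] at hg
    rcases hg with rfl | rfl | hg
    · exact hbase (e := s(u, q)) (e' := s(p, q)) hpqu.2.symm _ s(p, q) hpq
        (fun G hG a ha => ⟨hYu (hgiven _ G hG a ha).1, (hgiven _ G hG a ha).2⟩)
        (fun f hf hfg => absurd hfg (hYu hf)) hupq.symm hpqu.1 fun H hH => hH.2
    · exact hbase (e := s(u, p)) (e' := s(p, q)) hpqu.1.symm _ s(p, q) hpq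
        (fun G hG a ha => ⟨hYu (hgiven _ G hG a ha).1, (hgiven _ G hG a ha).2⟩)
        (fun f hf hfg => absurd hfg (hYu hf)) hupq hpqu.2 fun H hH => ⟨hH.1, hH.2.2⟩
    · exact hbase hupq g g hg
        (fun G hG a ha => ⟨hYu (hgiven _ G hG a ha).1, hYu (hgiven _ G hG a ha).1⟩)
        (fun f hf hfg => hfg) (hYu hg).symm (hYu hg).symm fun H hH => ⟨hH.1, hH.2.1⟩

theorem TwoTree.survives_of_path {u a b c : V} (h : TwoTree (X.filter (u ∉ ·)))
    (hN : ∀ w, s(u, w) ∈ X → w = a ∨ w = b ∨ w = c) (hab : a ≠ b) (hac' : a ≠ c) (hbc' : b ≠ c)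
    (hua : u ≠ a) (huc : u ≠ c) (hac : s(a, c) ∈ X) (hbc : s(b, c) ∉ X) :
    Survives arcEdge t (cyclicTriangles X) := by
  have hnbr : ∀ G ∈ trianglesGiven (X.filter (u ∉ ·)) s(a, c), ∀ d ∈ G, arcEdge d ≠ s(u, c) ∧
      arcEdge d ≠ s(a, c) := by
    rintro G ⟨H, hH, rfl⟩ d ⟨hd, hd'⟩
    refine ⟨fun hdc => ?_, hd'⟩
    have := (Finset.mem_filter.1 (arcEdge_mem_of_mem_cyclicTriangles hH hd)).2
    rw [hdc] at this
    simp at this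
  have hacu : u ∉ s(a, c) := by simp [hua, huc]
  have hmid : Survives arcEdge t {H' | ∃ H ∈ cyclicTriangles X, (∀ d ∈ H, arcEdge d ≠ s(u, b)) ∧
      H' = {d ∈ H | arcEdge d ≠ s(u, a)}} := by
    refine (h.survives_trianglesGiven s(a, c) (Finset.mem_filter.2 ⟨hac, hacu⟩)).of_pair
      (e := s(u, c)) (f := s(a, c)) (fun h => hacu (h ▸ Sym2.mem_mk_left _ _)) hnbr ?_
    rintro H' ⟨H, hH, hHb, rfl⟩
    rcases mem_cyclicTriangles_cases hH u with hH | ⟨y, z, -, -, hyz, hy, hz, -, rfl⟩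
    · refine .inl ⟨_, ⟨H, hH, rfl⟩, fun d hd => ⟨hd.1, fun hda => ?_⟩⟩
      have := (Finset.mem_filter.1 (arcEdge_mem_of_mem_cyclicTriangles hH hd.1)).2
      rw [hda] at this
      simp at this
    · have hb : y ≠ b ∧ z ≠ b := by
        constructor
        · rintro rfl
          exact hHb _ (Or.inl rfl) rfl
        · rintro rfl
          exact hHb _ (Or.inr (Or.inr rfl)) Sym2.eq_swap
      have hyz : (y = a ∧ z = c) ∨ (y = c ∧ z = a) := by
        rcases hN y hy with rfl | rfl | rfl <;> rcases hN z hz with rfl | rfl | rfl <;> simp_all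
      have h1 : s(u, c) ≠ s(u, a) := fun h => hac' (Sym2.congr_right.1 h).symm
      have h2 : s(a, c) ≠ s(u, a) := fun h => hacu (h ▸ Sym2.mem_mk_left _ _)
      obtain ⟨d, hd, hde⟩ : ∃ d ∈ cyclicArcs u y z, arcEdge d = s(u, c) :=
        exists_arc_of_edge (by rcases hyz with ⟨rfl, rfl⟩ | ⟨rfl, rfl⟩ <;> simp)
      obtain ⟨d', hd', hde'⟩ : ∃ d ∈ cyclicArcs u y z, arcEdge d = s(a, c) :=
        exists_arc_of_edge (by rcases hyz with ⟨rfl, rfl⟩ | ⟨rfl, rfl⟩ <;> simp [Sym2.eq_swap])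
      exact .inr ⟨⟨d, ⟨hd, hde ▸ h1⟩, hde⟩, d', ⟨hd', hde' ▸ h2⟩, hde'⟩
  refine hmid.of_pair (e := s(u, a)) (f := s(u, b)) (fun h => hab (Sym2.congr_right.1 h)) ?_ ?_
  · rintro G ⟨H, hH, hHb, rfl⟩ d ⟨hd, hd'⟩
    exact ⟨hd', hHb d hd⟩
  · intro H hH
    by_cases hb : ∀ d ∈ H, arcEdge d ≠ s(u, b)
    · exact .inl ⟨_, ⟨H, hH, hb, rfl⟩, Set.sep_subset _ _⟩
    refine .inr ⟨?_, by simpa using hb⟩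
    rcases mem_cyclicTriangles_cases hH u with hH | ⟨y, z, huy, huz, hyz, hy, hz, hyzX, rfl⟩
    · refine absurd ?_ hb
      intro d hd hda
      have := (Finset.mem_filter.1 (arcEdge_mem_of_mem_cyclicTriangles hH hd)).2
      rw [hda] at this
      simp at this
    · have hbyz : y = b ∨ z = b := by
        by_contra hcon
        rw [not_or] at hcon
        refine hb fun d hd hdb => ?_
        rcases arcEdge_of_mem_cyclicArcs hd with h | h | h
        · exact hcon.1 (Sym2.congr_right.1 (h.symm.trans hdb))
        · exact hcon.2 (Sym2.congr_right.1 (h.symm.trans hdb))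
        · have : u ∈ s(y, z) := (h.symm.trans hdb) ▸ Sym2.mem_mk_left u b
          rcases Sym2.mem_iff.1 this with h | h
          · exact huy h
          · exact huz h
      refine exists_arc_of_edge ?_
      rcases hN y hy with rfl | rfl | rfl <;> rcases hN z hz with rfl | rfl | rfl <;>
        simp_all [Sym2.eq_swap]

end Reductions

section Growth

variable {V : Type*} [DecidableEq V] {X : Finset (Sym2 V)}

/-- Every set of at most `25` vertices spans fewer than `15 / 8` edges per vertex. -/
def Sparse (X : Finset (Sym2 V)) : Prop :=
  ∀ S : Finset V, S.Nonempty → S.card ≤ 25 → 8 * (X ∩ S.sym2).card < 15 * S.card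

theorem Sparse.mono {Y : Finset (Sym2 V)} (hX : Sparse X) (h : Y ⊆ X) : Sparse Y :=
  fun S hS hcard => (Nat.mul_le_mul_left 8
    (Finset.card_le_card (Finset.inter_subset_inter_right h))).trans_lt (hX S hS hcard)

/-- The edges of `X` spanned by the first `n` terms of `v`. -/
def spanned (X : Finset (Sym2 V)) (v : ℕ → V) (n : ℕ) : Finset (Sym2 V) :=
  X ∩ ((Finset.range n).image v).sym2

theorem mk_mem_spanned {v : ℕ → V} {n : ℕ} {x y : V} :
    s(x, y) ∈ spanned X v n ↔ s(x, y) ∈ X ∧ (∃ i < n, v i = x) ∧ ∃ i < n, v i = y := by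
  simp [spanned]

/-- The terms of `v` before `n` are distinct, and each of them from `k` on is adjacent to both ends
of an edge spanned by earlier terms. -/
structure Growth (X : Finset (Sym2 V)) (v : ℕ → V) (k n : ℕ) : Prop where
  injOn : Set.InjOn v (Set.Iio n)
  attach : ∀ j, k ≤ j → j < n → ∃ p q, p < q ∧ q < j ∧
    s(v p, v q) ∈ X ∧ s(v p, v j) ∈ X ∧ s(v q, v j) ∈ X

theorem spanned_succ {v : ℕ → V} (hX : ∀ x, s(x, x) ∉ X) (n : ℕ) :
    spanned X v (n + 1) = spanned X v n ∪
      ((Finset.range n).filter fun i => s(v i, v n) ∈ X).image fun i => s(v i, v n) := by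
  ext e
  induction e with
  | _ x y =>
    rw [Finset.mem_union, mk_mem_spanned, mk_mem_spanned, Finset.mem_image]
    constructor
    · rintro ⟨hxy, ⟨i, hi, rfl⟩, j, hj, rfl⟩
      rcases Nat.lt_succ_iff_lt_or_eq.1 hi with hi' | rfl
      · rcases Nat.lt_succ_iff_lt_or_eq.1 hj with hj' | rfl
        · exact .inl ⟨hxy, ⟨i, hi', rfl⟩, j, hj', rfl⟩
        · exact .inr ⟨i, by simp [hi', hxy], rfl⟩
      · rcases Nat.lt_succ_iff_lt_or_eq.1 hj with hj' | rfl
        · exact .inr ⟨j, by simp [hj', Sym2.eq_swap, hxy], Sym2.eq_swap⟩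
        · exact absurd hxy (hX _)
    · rintro (⟨hxy, ⟨i, hi, rfl⟩, j, hj, rfl⟩ | ⟨i, hi, hxy⟩)
      · exact ⟨hxy, ⟨i, hi.trans n.lt_succ_self, rfl⟩, j, hj.trans n.lt_succ_self, rfl⟩
      · rw [Finset.mem_filter, Finset.mem_range] at hi
        refine ⟨hxy ▸ hi.2, ?_⟩
        rcases Sym2.eq_iff.1 hxy with ⟨rfl, rfl⟩ | ⟨rfl, rfl⟩
        · exact ⟨⟨i, by omega, rfl⟩, n, by omega, rfl⟩
        · exact ⟨⟨n, by omega, rfl⟩, i, by omega, rfl⟩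

theorem card_spanned {v : ℕ → V} (hX : ∀ x, s(x, x) ∉ X) {n : ℕ} (hv : Set.InjOn v (Set.Iio n)) :
    (spanned X v n).card = ∑ j ∈ Finset.range n, backDegree X v j := by
  induction n with
  | zero =>
    rw [Finset.range_zero, Finset.sum_empty, Finset.card_eq_zero, Finset.eq_empty_iff_forall_notMem]
    intro e
    induction e with
    | _ x y => simp [mk_mem_spanned]
  | succ n ih =>
    rw [spanned_succ hX, Finset.card_union_of_disjoint, Finset.sum_range_succ,
      ih (hv.mono (Set.Iio_subset_Iio n.le_succ)), Finset.card_image_of_injOn, backDegree]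
    · intro i hi j hj hij
      simp only [Finset.coe_filter, Finset.mem_range, Set.mem_ofPred_eq] at hi hj
      refine hv (Set.mem_Iio.2 (by omega)) (Set.mem_Iio.2 (by omega)) ?_
      exact Sym2.congr_left.1 hij
    · rw [Finset.disjoint_left]
      intro e he he'
      obtain ⟨i, -, rfl⟩ := Finset.mem_image.1 he'
      obtain ⟨-, -, j, hj, hjn⟩ := mk_mem_spanned.1 he
      have := hv (Set.mem_Iio.2 (by omega)) (Set.mem_Iio.2 n.lt_succ_self) hjn
      omega

theorem Growth.two_le_backDegree {v : ℕ → V} {k n : ℕ} (h : Growth X v k n) {j : ℕ} (hk : k ≤ j)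
    (hj : j < n) : 2 ≤ backDegree X v j := by
  obtain ⟨p, q, hpq, hqj, -, hp, hq⟩ := h.attach j hk hj
  refine (Finset.card_pair hpq.ne).symm.le.trans (Finset.card_le_card fun i hi => ?_)
  rw [Finset.mem_insert, Finset.mem_singleton] at hi
  rw [Finset.mem_filter, Finset.mem_range]
  rcases hi with rfl | rfl
  · exact ⟨hpq.trans hqj, hp⟩
  · exact ⟨hqj, hq⟩

theorem Growth.two_mul_le {v : ℕ → V} {k n : ℕ} (h : Growth X v k n) :
    2 * (n - k) ≤ ∑ j ∈ Finset.Ico k n, backDegree X v j := by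
  have : (Finset.Ico k n).card • 2 ≤ ∑ j ∈ Finset.Ico k n, backDegree X v j :=
    Finset.card_nsmul_le_sum _ _ 2 fun j hj =>
      h.two_le_backDegree (Finset.mem_Ico.1 hj).1 (Finset.mem_Ico.1 hj).2
  rw [Nat.card_Ico, smul_eq_mul] at this
  omega

theorem backDegree_congr {v w : ℕ → V} {k : ℕ} (h : ∀ i < k, w i = v i) {j : ℕ} (hj : j < k) :
    backDegree X w j = backDegree X v j := by
  unfold backDegree
  congr 1
  refine Finset.filter_congr fun i hi => ?_
  rw [h j hj, h i ((Finset.mem_range.1 hi).trans hj)]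

theorem Growth.eight_mul_lt {v : ℕ → V} {k n : ℕ} (h : Growth X v k n) (hX : ∀ x, s(x, x) ∉ X)
    (hS : Sparse X) (hn0 : 0 < n) (hn : n ≤ 25) :
    8 * ∑ j ∈ Finset.range n, backDegree X v j < 15 * n := by
  have hcard : ((Finset.range n).image v).card = n := by
    rw [Finset.card_image_of_injOn, Finset.card_range]
    simpa only [Finset.coe_range] using h.injOn
  have := hS ((Finset.range n).image v) (by simpa using hn0.ne') (by omega)
  rw [hcard] at this
  rwa [← card_spanned hX h.injOn]

theorem exists_closed_growth (hX : ∀ x, s(x, x) ∉ X) (hS : Sparse X) {v : ℕ → V} {k : ℕ}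
    (hv : Set.InjOn v (Set.Iio k)) (hk : k ≤ 25)
    (hedges : 2 * k ≤ ∑ j ∈ Finset.range k, backDegree X v j + 3) :
    ∃ w n, Growth X w k n ∧ k ≤ n ∧ n ≤ 25 ∧ (∀ i < k, w i = v i) ∧ ∀ p q, p < n → q < n → ∀ u,
      s(w p, w q) ∈ X → s(w p, u) ∈ X → s(w q, u) ∈ X → ∃ i < n, w i = u := by
  by_contra! hcon
  have hgrow : ∀ m, k + m ≤ 25 → ∃ w, Growth X w k (k + m) ∧ ∀ i < k, w i = v i := by
    intro m
    induction m with
    | zero => exact fun _ => ⟨v, ⟨hv, fun j h1 h2 => absurd h1 (not_le.2 h2)⟩, fun _ _ => rfl⟩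
    | succ m ih =>
      intro hm
      obtain ⟨w, hw, hwv⟩ := ih (by omega)
      obtain ⟨p, q, hp, hq, u, hpq, hpu, hqu, hu⟩ := hcon w (k + m) hw (by omega) (by omega) hwv
      have hup : ∀ {j}, j < k + m → Function.update w (k + m) u j = w j := fun h =>
        Function.update_of_ne h.ne _ _
      have hlt : ∀ {i}, i < k + (m + 1) → i < k + m ∨ i = k + m := by omega
      refine ⟨Function.update w (k + m) u, ⟨?_, ?_⟩, fun i hi => by
        rw [hup (by omega), hwv i hi]⟩
      · intro i hi j hj hij
        rw [Set.mem_Iio] at hi hj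
        rcases hlt hi with hi' | rfl
        · rcases hlt hj with hj' | rfl
          · rw [hup hi', hup hj'] at hij
            exact hw.injOn hi' hj' hij
          · rw [hup hi', Function.update_self] at hij
            exact absurd hij (hu i hi')
        · rcases hlt hj with hj' | rfl
          · rw [hup hj', Function.update_self] at hij
            exact absurd hij.symm (hu j hj')
          · rfl
      · intro j hkj hj
        rcases hlt hj with hj' | rfl
        · obtain ⟨a, b, hab, hbj, h1, h2, h3⟩ := hw.attach j hkj hj'
          refine ⟨a, b, hab, hbj, ?_⟩
          rw [hup hj', hup (hbj.trans hj'), hup ((hab.trans hbj).trans hj')]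
          exact ⟨h1, h2, h3⟩
        · rcases lt_trichotomy p q with h | rfl | h
          · refine ⟨p, q, h, hq, ?_⟩
            rw [hup hp, hup hq, Function.update_self]
            exact ⟨hpq, hpu, hqu⟩
          · exact absurd hpq (hX _)
          · refine ⟨q, p, h, hp, ?_⟩
            rw [hup hp, hup hq, Function.update_self]
            exact ⟨Sym2.eq_swap ▸ hpq, hqu, hpu⟩
  obtain ⟨w, hw, hwv⟩ := hgrow (25 - k) (by omega)
  have h1 := hw.two_mul_le
  have h2 : ∑ j ∈ Finset.range k, backDegree X w j = ∑ j ∈ Finset.range k, backDegree X v j :=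
    Finset.sum_congr rfl fun j hj => backDegree_congr hwv (Finset.mem_range.1 hj)
  have h3 := Finset.sum_range_add_sum_Ico (backDegree X w) (Nat.le_add_right k (25 - k))
  have h4 := hw.eight_mul_lt hX hS (by omega) (by omega)
  omega

/-- A sparse loopless board on which every vertex has degree at least `3`, every edge lies in a
triangle, and the edges cannot be split by a set of vertices closed under attaching triangles. -/
structure IsReduced (X : Finset (Sym2 V)) : Prop where
  loopless : ∀ x, s(x, x) ∉ X
  sparse : Sparse X
  closed : ∀ S : Finset V,
    (∀ p q u, p ∈ S → q ∈ S → s(p, q) ∈ X → s(p, u) ∈ X → s(q, u) ∈ X → u ∈ S) →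
    (X ∩ S.sym2).Nonempty → X ⊆ S.sym2
  triangle : ∀ x y, s(x, y) ∈ X → ∃ z, s(x, z) ∈ X ∧ s(y, z) ∈ X
  degree : ∀ u w, s(u, w) ∈ X → ∀ N : Finset V, (∀ w, s(u, w) ∈ X → w ∈ N) → 3 ≤ N.card

/-- A growth exhausting a reduced board. -/
structure ExhaustingGrowth (X : Finset (Sym2 V)) (w : ℕ → V) (k n : ℕ) : Prop
    extends Growth X w k n where
  exhaust : ∀ x y, s(x, y) ∈ X → ∃ i < n, w i = x
  degree : ∀ i < n, 3 ≤ ((Finset.range n).filter fun j => s(w i, w j) ∈ X).card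
  last : 3 ≤ backDegree X w (n - 1)
  lt : 8 * X.card < 15 * n
  card : X.card = ∑ j ∈ Finset.range k, backDegree X w j + ∑ j ∈ Finset.Ico k n, backDegree X w j

theorem IsReduced.exists_growth (hX : IsReduced X) {v : ℕ → V} {k : ℕ}
    (hv : Set.InjOn v (Set.Iio k)) (hk : k ≤ 25) (hk0 : 0 < k)
    (hedges : 2 * k ≤ ∑ j ∈ Finset.range k, backDegree X v j + 3)
    (hadj : ∀ i < k, ∃ j < k, s(v i, v j) ∈ X) :
    ∃ w n, ExhaustingGrowth X w k n ∧ k ≤ n ∧ ∀ i < k, w i = v i := by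
  obtain ⟨w, n, hw, hkn, hn, hwv, hcl⟩ := exists_closed_growth hX.loopless hX.sparse hv hk hedges
  have hsub : X ⊆ ((Finset.range n).image w).sym2 := by
    refine hX.closed _ ?_ ?_
    · intro p q u hp hq hpq hpu hqu
      obtain ⟨i, hi, rfl⟩ := Finset.mem_image.1 hp
      obtain ⟨j, hj, rfl⟩ := Finset.mem_image.1 hq
      obtain ⟨l, hl, rfl⟩ := hcl i j (Finset.mem_range.1 hi) (Finset.mem_range.1 hj) u hpq hpu hqu
      exact Finset.mem_image_of_mem _ (Finset.mem_range.2 hl)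
    · obtain ⟨j, hj, h0j⟩ := hadj 0 hk0
      refine ⟨s(v 0, v j), mk_mem_spanned.2 ⟨h0j, ⟨0, by omega, hwv 0 hk0⟩, j, by omega, hwv j hj⟩⟩
  have hexh : ∀ x y, s(x, y) ∈ X → ∃ i < n, w i = x := by
    intro x y hxy
    have := (Finset.mk_mem_sym2_iff.1 (hsub hxy)).1
    simpa using this
  have hspan : spanned X w n = X := Finset.inter_eq_left.2 hsub
  have hdeg : ∀ i < n, 3 ≤ ((Finset.range n).filter fun j => s(w i, w j) ∈ X).card := by
    intro i hi
    obtain ⟨y, hy⟩ : ∃ y, s(w i, y) ∈ X := by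
      by_cases hik : i < k
      · obtain ⟨j, hj, hij⟩ := hadj i hik
        exact ⟨v j, hwv i hik ▸ hij⟩
      · obtain ⟨p, q, -, -, -, -, hq⟩ := hw.attach i (by omega) hi
        exact ⟨_, Sym2.eq_swap ▸ hq⟩
    refine (hX.degree (w i) y hy (((Finset.range n).filter fun j => s(w i, w j) ∈ X).image w)
      ?_).trans Finset.card_image_le
    intro z hz
    obtain ⟨j, hj, rfl⟩ := hexh z (w i) (Sym2.eq_swap ▸ hz)
    exact Finset.mem_image_of_mem _ (Finset.mem_filter.2 ⟨Finset.mem_range.2 hj, hz⟩)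
  have hcard := card_spanned hX.loopless hw.injOn
  rw [hspan] at hcard
  refine ⟨w, n, ⟨hw, hexh, hdeg, ?_, ?_, ?_⟩, hkn, hwv⟩
  · refine (hdeg (n - 1) (by omega)).trans (Finset.card_le_card fun i hi => ?_)
    rw [Finset.mem_filter, Finset.mem_range] at hi ⊢
    have : i ≠ n - 1 := by
      rintro rfl
      exact hX.loopless _ hi.2
    exact ⟨by omega, Sym2.eq_swap ▸ hi.2⟩
  · rw [hcard]
    exact hw.eight_mul_lt hX.loopless hX.sparse (by omega) hn
  · rw [hcard, Finset.sum_range_add_sum_Ico _ hkn]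

theorem ExhaustingGrowth.le_sum {w : ℕ → V} {k n : ℕ} (h : ExhaustingGrowth X w k n)
    (hkn : k < n) : 2 * (n - k) + 1 ≤ ∑ j ∈ Finset.Ico k n, backDegree X w j := by
  obtain ⟨m, rfl⟩ : ∃ m, n = m + 1 := ⟨n - 1, by omega⟩
  have h1 : Growth X w k m := ⟨h.injOn.mono (Set.Iio_subset_Iio m.le_succ),
    fun j hj hjm => h.attach j hj (by omega)⟩
  have h2 := h1.two_mul_le
  have h3 := h.last
  rw [Finset.sum_Ico_succ_top (by omega)]
  simp only [Nat.add_sub_cancel] at h3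
  omega

end Growth

section ReducedBoards

variable {V : Type*} [DecidableEq V] {X : Finset (Sym2 V)}

/-- `X` contains no complete graph on four vertices. -/
def NoK4 (X : Finset (Sym2 V)) : Prop :=
  ∀ a b c d, ¬(s(a, b) ∈ X ∧ s(a, c) ∈ X ∧ s(a, d) ∈ X ∧ s(b, c) ∈ X ∧ s(b, d) ∈ X ∧ s(c, d) ∈ X)

theorem ExhaustingGrowth.survives {w : ℕ → V} {k n m b G : ℕ} (h : ExhaustingGrowth X w k n)
    (hX : IsReduced X) (hn : n ≤ 7) (hkn : k + m = n) (hG : IsGraphCode X w k G) {noK4 : Bool}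
    (hK : noK4 = true → NoK4 X) {o : Bool} {fuel : ℕ}
    (hb : ∑ j ∈ Finset.Ico k n, backDegree X w j = b + 2 * m)
    (he : explore noK4 (leafCheck o fuel n) m k b G = true) (t : ℕ) :
    Survives arcEdge t (cyclicTriangles X) :=
  survives_of_explore hn h.injOn hX.loopless h.exhaust h.degree hX.triangle hK hkn h.attach hb hG
    he t

theorem injOn_Iio_of_ne {v : ℕ → V} {k : ℕ} (h : ∀ j < k, ∀ i < j, v i ≠ v j) :
    Set.InjOn v (Set.Iio k) := by
  intro i hi j hj hij
  rcases lt_trichotomy i j with hlt | rfl | hlt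
  · exact absurd hij (h j hj i hlt)
  · rfl
  · exact absurd hij.symm (h i hi j hlt)

theorem isGraphCode_of_lt {v : ℕ → V} {k G : ℕ} (hG : G < 2 ^ (8 * k))
    (h : ∀ j < k, ∀ i < 8, G.testBit (8 * j + i) = true ↔ i < j ∧ s(v i, v j) ∈ X) :
    IsGraphCode X v k G := by
  intro j i hi
  by_cases hj : j < k
  · rw [h j hj i hi]
    simp [hj]
  · rw [Nat.testBit_lt_two_pow (hG.trans_le (Nat.pow_le_pow_right (by norm_num) (by omega)))]
    simp [hj]

theorem IsReduced.survives_of_diamond (hX : IsReduced X) (hK : NoK4 X) {l : ℕ}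
    (hodd : X.card = 2 * l + 1) (hl : 3 ≤ l)
    {a b c d : V} (hab : s(a, b) ∈ X) (hac : s(a, c) ∈ X) (hbc : s(b, c) ∈ X) (had : s(a, d) ∈ X)
    (hbd : s(b, d) ∈ X) (hcd' : c ≠ d) (t : ℕ) : Survives arcEdge t (cyclicTriangles X) := by
  have hcd : s(c, d) ∉ X := fun h => hK a b c d ⟨hab, hac, had, hbc, hbd, h⟩
  have hne : ∀ {x y}, s(x, y) ∈ X → x ≠ y := by
    rintro x y h rfl
    exact hX.loopless _ h
  have hab' := hne hab
  have hac' := hne hac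
  have hbc' := hne hbc
  have had' := hne had
  have hbd' := hne hbd
  let v : ℕ → V := fun i => if i = 0 then a else if i = 1 then b else if i = 2 then c else d
  have hv : Set.InjOn v (Set.Iio 4) := by
    refine injOn_Iio_of_ne fun j hj i hi => ?_
    interval_cases j <;> interval_cases i <;> simp [v, *]
  have hsum : ∑ j ∈ Finset.range 4, backDegree X v j = 5 := by
    simp only [backDegree, Finset.card_filter, Finset.sum_range_succ, Finset.sum_range_zero]
    simp [v, hab, hac, hbc, had, hbd, hcd]
  have hba : s(b, a) ∈ X := Sym2.eq_swap ▸ hab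
  have hca : s(c, a) ∈ X := Sym2.eq_swap ▸ hac
  have hda : s(d, a) ∈ X := Sym2.eq_swap ▸ had
  obtain ⟨w, n, hw, hn, hwv⟩ := hX.exists_growth hv (by norm_num) (by norm_num) (by omega) (by
    intro i hi
    by_cases h0 : i = 0
    · exact ⟨1, by omega, by simpa [v, h0] using hab⟩
    · refine ⟨0, by omega, ?_⟩
      interval_cases i <;> simp_all [v])
  have hG : IsGraphCode X w 4 50528512 := by
    refine isGraphCode_of_lt (by norm_num) fun j hj i hi => ?_
    by_cases hij : i < j
    · rw [hwv j hj, hwv i (by omega)]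
      interval_cases j <;> interval_cases i <;>
        simp [v, hab, hac, hbc, had, hbd, hcd, Nat.testBit_eq_decide_div_mod_eq]
    · simp only [hij, false_and, iff_false]
      interval_cases j <;> interval_cases i <;> simp_all [Nat.testBit_eq_decide_div_mod_eq]
  have hsum' : ∑ j ∈ Finset.range 4, backDegree X w j = 5 := by
    rw [← hsum]
    exact Finset.sum_congr rfl fun j hj => backDegree_congr hwv (Finset.mem_range.1 hj)
  have hcard := hw.card
  have hlt := hw.lt
  have h4 : n ≠ 4 := by
    rintro rfl
    rw [Finset.Ico_self, Finset.sum_empty] at hcard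
    omega
  have hle := hw.le_sum (by omega)
  have hS : ∑ j ∈ Finset.Ico 4 n, backDegree X w j = 2 + 2 * (n - 4) := by omega
  obtain rfl | rfl | rfl : n = 5 ∨ n = 6 ∨ n = 7 := by omega
  · exact hw.survives hX (by norm_num) (m := 1) rfl hG (fun _ => hK) hS explore_diamond_five t
  · exact hw.survives hX (by norm_num) (m := 2) rfl hG (fun _ => hK) hS explore_diamond_six t
  · exact hw.survives hX (by norm_num) (m := 3) rfl hG (fun _ => hK) hS explore_diamond_seven t

theorem IsReduced.survives_of_K4_of_lt (hX : IsReduced X) {l : ℕ} (hodd : X.card = 2 * l + 1)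
    {a b c d e : V} (hab : s(a, b) ∈ X) (hac : s(a, c) ∈ X) (had : s(a, d) ∈ X) (hbc : s(b, c) ∈ X)
    (hbd : s(b, d) ∈ X) (hcd : s(c, d) ∈ X) (hae : s(a, e) ∈ X) (hbe : s(b, e) ∈ X)
    (hce : s(c, e) ∉ X) (hde : s(d, e) ∉ X) (hce' : c ≠ e) (hde' : d ≠ e) (t : ℕ) :
    Survives arcEdge t (cyclicTriangles X) := by
  have hne : ∀ {x y}, s(x, y) ∈ X → x ≠ y := by
    rintro x y h rfl
    exact hX.loopless _ h
  have hab' := hne hab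
  have hac' := hne hac
  have hbc' := hne hbc
  have had' := hne had
  have hbd' := hne hbd
  have hcd' := hne hcd
  have hae' := hne hae
  have hbe' := hne hbe
  let v : ℕ → V := fun i => if i = 0 then a else if i = 1 then b else if i = 2 then c else
    if i = 3 then d else e
  have hv : Set.InjOn v (Set.Iio 5) := by
    refine injOn_Iio_of_ne fun j hj i hi => ?_
    interval_cases j <;> interval_cases i <;> simp [v, *]
  have hsum : ∑ j ∈ Finset.range 5, backDegree X v j = 8 := by
    simp only [backDegree, Finset.card_filter, Finset.sum_range_succ, Finset.sum_range_zero]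
    simp [v, hab, hac, hbc, had, hbd, hcd,
      hae, hbe, hce, hde]
  have hba : s(b, a) ∈ X := Sym2.eq_swap ▸ hab
  have hca : s(c, a) ∈ X := Sym2.eq_swap ▸ hac
  have hda : s(d, a) ∈ X := Sym2.eq_swap ▸ had
  have hea : s(e, a) ∈ X := Sym2.eq_swap ▸ hae
  obtain ⟨w, n, hw, hn, hwv⟩ := hX.exists_growth hv (by norm_num) (by norm_num) (by omega) (by
    intro i hi
    by_cases h0 : i = 0
    · exact ⟨1, by omega, by simpa [v, h0] using hab⟩
    · refine ⟨0, by omega, ?_⟩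
      interval_cases i <;> simp_all [v])
  have hG : IsGraphCode X w 5 13002539264 := by
    refine isGraphCode_of_lt (by norm_num) fun j hj i hi => ?_
    by_cases hij : i < j
    · rw [hwv j hj, hwv i (by omega)]
      interval_cases j <;> interval_cases i <;>
        simp [v, hab, hac, hbc, had, hbd, hcd, hae, hbe, hce, hde,
          Nat.testBit_eq_decide_div_mod_eq]
    · simp only [hij, false_and, iff_false]
      interval_cases j <;> interval_cases i <;> simp_all [Nat.testBit_eq_decide_div_mod_eq]
  have hsum' : ∑ j ∈ Finset.range 5, backDegree X w j = 8 := by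
    rw [← hsum]
    exact Finset.sum_congr rfl fun j hj => backDegree_congr hwv (Finset.mem_range.1 hj)
  have hcard := hw.card
  have hlt := hw.lt
  have h5 : n ≠ 5 := by
    rintro rfl
    rw [Finset.Ico_self, Finset.sum_empty] at hcard
    omega
  have hle := hw.le_sum (by omega)
  have hS : ∑ j ∈ Finset.Ico 5 n, backDegree X w j = 1 + 2 * (n - 5) := by omega
  obtain rfl | rfl : n = 6 ∨ n = 7 := by omega
  · exact hw.survives hX (by norm_num) (m := 1) rfl hG (noK4 := false) nofun hS explore_six t
  · exact hw.survives hX (by norm_num) (m := 2) rfl hG (noK4 := false) nofun hS explore_seven t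

end ReducedBoards

section ReducedBoards

variable {V : Type*} [DecidableEq V] {X : Finset (Sym2 V)}

theorem IsReduced.survives_of_K4 (hX : IsReduced X) {a b c d : V} (hab : s(a, b) ∈ X)
    (hac : s(a, c) ∈ X) (had : s(a, d) ∈ X) (hbc : s(b, c) ∈ X) (hbd : s(b, d) ∈ X)
    (hcd : s(c, d) ∈ X) (t : ℕ) : Survives arcEdge t (cyclicTriangles X) := by
  have hne : ∀ {x y}, s(x, y) ∈ X → x ≠ y := by
    rintro x y h rfl
    exact hX.loopless _ h
  have hab' := hne hab
  have hac' := hne hac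
  have hbc' := hne hbc
  have had' := hne had
  have hbd' := hne hbd
  have hcd' := hne hcd
  let v : ℕ → V := fun i => if i = 0 then a else if i = 1 then b else if i = 2 then c else d
  have hv : Set.InjOn v (Set.Iio 4) := by
    refine injOn_Iio_of_ne fun j hj i hi => ?_
    interval_cases j <;> interval_cases i <;> simp [v, *]
  have hba : s(b, a) ∈ X := Sym2.eq_swap ▸ hab
  have hca : s(c, a) ∈ X := Sym2.eq_swap ▸ hac
  have hda : s(d, a) ∈ X := Sym2.eq_swap ▸ had
  have hcb : s(c, b) ∈ X := Sym2.eq_swap ▸ hbc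
  have hdb : s(d, b) ∈ X := Sym2.eq_swap ▸ hbd
  have hdc : s(d, c) ∈ X := Sym2.eq_swap ▸ hcd
  have hvX : ∀ i < 4, ∀ j < 4, i ≠ j → s(v i, v j) ∈ X := by
    intro i hi j hj hij
    interval_cases i <;> interval_cases j <;> first | exact absurd rfl hij | assumption
  have hsum : ∑ j ∈ Finset.range 4, backDegree X v j = 6 := by
    simp only [backDegree, Finset.card_filter, Finset.sum_range_succ, Finset.sum_range_zero]
    simp [v, hab, hac, hbc, had, hbd, hcd]
  obtain ⟨w, n, hw, hn, hwv⟩ := hX.exists_growth hv (by norm_num) (by norm_num) (by omega) (by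
    intro i hi
    by_cases h0 : i = 0
    · exact ⟨1, by omega, hvX _ hi _ (by omega) (by omega)⟩
    · exact ⟨0, by omega, hvX _ hi _ (by omega) h0⟩)
  have hwX : ∀ i < 4, ∀ j < 4, i ≠ j → s(w i, w j) ∈ X := fun i hi j hj hij => by
    rw [hwv i hi, hwv j hj]
    exact hvX i hi j hj hij
  have hG : IsGraphCode X w 4 117637376 := by
    refine isGraphCode_of_lt (by norm_num) fun j hj i hi => ?_
    by_cases hij : i < j
    · rw [and_iff_right hij, iff_true_right (hwX i (by omega) j hj hij.ne)]
      interval_cases j <;> interval_cases i <;> rfl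
    · simp only [hij, false_and, iff_false]
      interval_cases j <;> interval_cases i <;> first | omega | decide
  have hsum' : ∑ j ∈ Finset.range 4, backDegree X w j = 6 := by
    rw [← hsum]
    exact Finset.sum_congr rfl fun j hj => backDegree_congr hwv (Finset.mem_range.1 hj)
  have hcard := hw.card
  have hlt := hw.lt
  obtain rfl | h4 : n = 4 ∨ 4 < n := by omega
  · exact hw.survives hX (by norm_num) (m := 0) rfl hG (noK4 := false) nofun (b := 0)
      (by simp) explore_four t
  have hle := hw.le_sum h4
  obtain rfl | h5 : n = 5 ∨ 5 < n := by omega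
  · exact hw.survives hX (by norm_num) (m := 1) rfl hG (noK4 := false) nofun
      (by omega) explore_five t
  have h4deg : backDegree X w 4 = 2 := by
    have h1 : ∑ j ∈ Finset.Ico 4 n, backDegree X w j =
        backDegree X w 4 + ∑ j ∈ Finset.Ico 5 n, backDegree X w j :=
      Finset.sum_eq_sum_Ico_succ_bot h4 _
    have h2 : ExhaustingGrowth X w 5 n :=
      { hw with
        attach := fun j hj => hw.attach j (by omega)
        card := by rw [Finset.sum_range_succ, hcard, h1, add_assoc] }
    have h3 := h2.le_sum h5
    have h4 := hw.two_le_backDegree le_rfl h4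
    omega
  have hfour : ∀ p q r s, p < 4 → q < 4 → r < 4 → s < 4 → p ≠ q → p ≠ r → p ≠ s → q ≠ r → q ≠ s →
      r ≠ s → s(w p, w 4) ∈ X → s(w q, w 4) ∈ X → Survives arcEdge t (cyclicTriangles X) := by
    intro p q r s hp hq hr hs hpq hpr hps hqr hqs hrs hp4 hq4
    have hnot : ∀ r < 4, r ≠ p → r ≠ q → s(w r, w 4) ∉ X := by
      intro r hr hrp hrq hr4
      have : ({p, q, r} : Finset ℕ) ⊆ (Finset.range 4).filter fun i => s(w i, w 4) ∈ X := by
        intro i hi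
        simp only [Finset.mem_insert, Finset.mem_singleton] at hi
        rw [Finset.mem_filter, Finset.mem_range]
        rcases hi with rfl | rfl | rfl
        exacts [⟨hp, hp4⟩, ⟨hq, hq4⟩, ⟨hr, hr4⟩]
      have := Finset.card_le_card this
      rw [Finset.card_eq_three.2 ⟨p, q, r, hpq, hrp.symm, hrq.symm, rfl⟩] at this
      have : 3 ≤ backDegree X w 4 := this
      omega
    have hw4 : ∀ r < 4, w r ≠ w 4 := fun r hr h => by
      have := hw.injOn (Set.mem_Iio.2 (by omega)) (Set.mem_Iio.2 h4) h
      omega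
    refine hX.survives_of_K4_of_lt (l := n - 1) (by omega) (hwX p hp q hq hpq) (hwX p hp r hr hpr)
      (hwX p hp s hs hps) (hwX q hq r hr hqr) (hwX q hq s hs hqs) (hwX r hr s hs hrs) hp4 hq4
      (hnot r hr hpr.symm hqr.symm) (hnot s hs hps.symm hqs.symm) (hw4 r hr) (hw4 s hs) t
  obtain ⟨p, q, hpq, hq4, -, hp, hq⟩ := hw.attach 4 le_rfl h4
  obtain ⟨r, s, hr, hs, h1, h2, h3, h4', h5'⟩ : ∃ r s, r < 4 ∧ s < 4 ∧ p ≠ r ∧ p ≠ s ∧ q ≠ r ∧ q ≠ s ∧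
      r ≠ s := by
    interval_cases q <;> interval_cases p
    · exact ⟨2, 3, by decide⟩
    · exact ⟨1, 3, by decide⟩
    · exact ⟨0, 3, by decide⟩
    · exact ⟨1, 2, by decide⟩
    · exact ⟨0, 2, by decide⟩
    · exact ⟨0, 1, by decide⟩
  exact hfour p q r s (by omega) hq4 hr hs hpq.ne h1 h2 h3 h4' h5' hp hq

theorem Growth.twoTree {w : ℕ → V} {n : ℕ} (hX : ∀ x, s(x, x) ∉ X) (hw : Growth X w 2 n)
    (h01 : s(w 0, w 1) ∈ X) (hn : 2 ≤ n) (hdeg : ∀ j, 2 ≤ j → j < n → backDegree X w j = 2) :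
    TwoTree (spanned X w n) := by
  induction n, hn using Nat.le_induction with
  | base =>
    have h : spanned X w 2 = {s(w 0, w 1)} := by
      ext e
      induction e with
      | _ x y =>
        rw [mk_mem_spanned, Finset.mem_singleton]
        constructor
        · rintro ⟨hxy, ⟨i, hi, rfl⟩, j, hj, rfl⟩
          interval_cases i <;> interval_cases j
          · exact absurd hxy (hX _)
          · rfl
          · exact Sym2.eq_swap
          · exact absurd hxy (hX _)
        · intro h
          refine ⟨h ▸ h01, ?_⟩
          rcases Sym2.eq_iff.1 h with ⟨rfl, rfl⟩ | ⟨rfl, rfl⟩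
          · exact ⟨⟨0, by norm_num, rfl⟩, 1, by norm_num, rfl⟩
          · exact ⟨⟨1, by norm_num, rfl⟩, 0, by norm_num, rfl⟩
    rw [h]
    exact .edge fun h => hX _ (h ▸ h01)
  | succ n hn ih =>
    have ih := ih ⟨hw.injOn.mono (Set.Iio_subset_Iio n.le_succ),
      fun j hj hjn => hw.attach j hj (by omega)⟩ fun j hj hjn => hdeg j hj (by omega)
    obtain ⟨p, q, hpq, hqn, hpqX, hpX, hqX⟩ := hw.attach n hn n.lt_succ_self
    have hfil : (Finset.range n).filter (fun i => s(w i, w n) ∈ X) = {p, q} := by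
      symm
      refine Finset.eq_of_subset_of_card_le ?_ ?_
      · intro i hi
        rw [Finset.mem_insert, Finset.mem_singleton] at hi
        rw [Finset.mem_filter, Finset.mem_range]
        rcases hi with rfl | rfl
        · exact ⟨hpq.trans hqn, hpX⟩
        · exact ⟨hqn, hqX⟩
      · rw [Finset.card_pair hpq.ne]
        exact (hdeg n hn n.lt_succ_self).le
    rw [spanned_succ hX, hfil, Finset.image_insert, Finset.image_singleton, Finset.union_comm,
      Finset.insert_union, Finset.singleton_union, Sym2.eq_swap, Sym2.eq_swap (a := w q)]
    refine ih.attach (mk_mem_spanned.2 ⟨hpqX, ⟨p, by omega, rfl⟩, q, hqn, rfl⟩) fun z hz => ?_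
    obtain ⟨-, ⟨i, hi, hin⟩, -⟩ := mk_mem_spanned.1 hz
    have := hw.injOn (Set.mem_Iio.2 (by omega)) (Set.mem_Iio.2 n.lt_succ_self) hin
    omega

theorem TwoTree.survives_of_three {u a b c : V} (h : TwoTree (X.filter (u ∉ ·))) (hX : IsReduced X)
    (hK : NoK4 X) (hN : ∀ w, s(u, w) ∈ X → w = a ∨ w = b ∨ w = c) (hab : a ≠ b) (hac : a ≠ c)
    (hbc : b ≠ c) (hua : s(u, a) ∈ X) (hub : s(u, b) ∈ X) (huc : s(u, c) ∈ X) (t : ℕ) :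
    Survives arcEdge t (cyclicTriangles X) := by
  have hne : ∀ {x y}, s(x, y) ∈ X → x ≠ y := by
    rintro x y h rfl
    exact hX.loopless _ h
  have hlink : ∀ x, s(u, x) ∈ X → s(x, a) ∈ X ∨ s(x, b) ∈ X ∨ s(x, c) ∈ X := by
    intro x hx
    obtain ⟨z, huz, hxz⟩ := hX.triangle u x hx
    rcases hN z huz with rfl | rfl | rfl
    · exact .inl hxz
    · exact .inr (.inl hxz)
    · exact .inr (.inr hxz)
  have ha := (hlink a hua).resolve_left (hX.loopless a)
  have hb := hlink b hub
  have hc := hlink c huc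
  rw [Sym2.eq_swap, or_iff_right (hX.loopless b)] at hb
  rw [Sym2.eq_swap, Sym2.eq_swap (b := b), or_iff_left (hX.loopless c)] at hc
  by_cases hbcX : s(b, c) ∈ X
  · by_cases habX : s(a, b) ∈ X
    · have hacX : s(a, c) ∉ X := fun hacX => hK u a b c ⟨hua, hub, huc, habX, hacX, hbcX⟩
      exact h.survives_of_path (a := b) (b := a) (c := c) (fun w hw => by
        rcases hN w hw with h | h | h <;> simp [h]) hab.symm hbc hac (hne hub) (hne huc) hbcX hacX
    · have hacX : s(a, c) ∈ X := ha.resolve_left habX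
      exact h.survives_of_path (a := c) (b := a) (c := b) (fun w hw => by
        rcases hN w hw with h | h | h <;> simp [h]) hac.symm hbc.symm hab (hne huc) (hne hub)
        (Sym2.eq_swap ▸ hbcX) habX
  · exact h.survives_of_path hN hab hac hbc (hne hua) (hne huc) (hc.resolve_right hbcX) hbcX

theorem IsReduced.survives_of_noK4 (hX : IsReduced X) (hK : NoK4 X) {x y : V} (hxy : s(x, y) ∈ X)
    (t : ℕ) : Survives arcEdge t (cyclicTriangles X) := by
  have hxy' : x ≠ y := by
    rintro rfl
    exact hX.loopless _ hxy
  let v : ℕ → V := fun i => if i = 0 then x else y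
  have hv : Set.InjOn v (Set.Iio 2) := by
    refine injOn_Iio_of_ne fun j hj i hi => ?_
    interval_cases j <;> interval_cases i <;> simp [v, *]
  have hsum : ∑ j ∈ Finset.range 2, backDegree X v j = 1 := by
    simp only [backDegree, Finset.card_filter, Finset.sum_range_succ, Finset.sum_range_zero]
    simp [v, hxy]
  obtain ⟨w, n, hw, hn, hwv⟩ := hX.exists_growth hv (by norm_num) (by norm_num) (by omega) (by
    intro i hi
    interval_cases i
    · exact ⟨1, by norm_num, hxy⟩
    · exact ⟨0, by norm_num, Sym2.eq_swap ▸ hxy⟩)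
  have hsum' : ∑ j ∈ Finset.range 2, backDegree X w j = 1 := by
    rw [← hsum]
    exact Finset.sum_congr rfl fun j hj => backDegree_congr hwv (Finset.mem_range.1 hj)
  have hcard := hw.card
  have hlt := hw.lt
  have hn4 : 4 ≤ n := by
    by_contra hcon
    have h1 := hw.degree 0 (by omega)
    have h2 : (Finset.range n).filter (fun j => s(w 0, w j) ∈ X) ⊆ (Finset.range n).erase 0 := by
      intro i hi
      rw [Finset.mem_filter] at hi
      refine Finset.mem_erase.2 ⟨?_, hi.1⟩
      rintro rfl
      exact hX.loopless _ hi.2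
    have h3 := Finset.card_le_card h2
    rw [Finset.card_erase_of_mem (Finset.mem_range.2 (by omega)), Finset.card_range] at h3
    omega
  have hle := hw.le_sum (by omega)
  obtain ⟨m, rfl⟩ : ∃ m, n = m + 1 := ⟨n - 1, by omega⟩
  have hw01 : s(w 0, w 1) ∈ X := by
    rw [hwv 0 (by norm_num), hwv 1 (by norm_num)]
    exact hxy
  obtain hc | hc : X.card = 2 * m ∨ X.card = 2 * m + 1 := by omega
  · have hw' : Growth X w 2 m := ⟨hw.injOn.mono (Set.Iio_subset_Iio m.le_succ),
      fun j hj hjn => hw.attach j hj (by omega)⟩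
    have hlast : 3 ≤ backDegree X w m := hw.last
    have htop := Finset.sum_Ico_succ_top (show 2 ≤ m by omega) (backDegree X w)
    have hm2 := hw'.two_mul_le
    have hall : ∀ j, 2 ≤ j → j < m → backDegree X w j = 2 := by
      have h2 : ∀ j ∈ Finset.Ico 2 m, 2 ≤ backDegree X w j := fun j hj =>
        hw'.two_le_backDegree (Finset.mem_Ico.1 hj).1 (Finset.mem_Ico.1 hj).2
      have := (Finset.sum_eq_sum_iff_of_le h2).1 (by
        rw [Finset.sum_const, Nat.card_Ico, smul_eq_mul]
        omega)
      exact fun j hj hjm => (this j (Finset.mem_Ico.2 ⟨hj, hjm⟩)).symm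
    have htree := hw'.twoTree hX.loopless hw01 (by omega) hall
    have hspan : spanned X w m = X.filter (w m ∉ ·) := by
      ext e
      induction e with
      | _ x y =>
        rw [mk_mem_spanned, Finset.mem_filter, Sym2.mem_iff, not_or]
        have hout : ∀ z, (∃ i < m, w i = z) → w m ≠ z := by
          rintro z ⟨i, hi, rfl⟩ h
          have := hw.injOn (Set.mem_Iio.2 m.lt_succ_self) (Set.mem_Iio.2 (by omega)) h
          omega
        have hin : ∀ z, (∃ i < m + 1, w i = z) → w m ≠ z → ∃ i < m, w i = z := by
          rintro z ⟨i, hi, rfl⟩ h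
          have : i ≠ m := by rintro rfl; exact h rfl
          exact ⟨i, by omega, rfl⟩
        constructor
        · rintro ⟨h, h1, h2⟩
          exact ⟨h, hout _ h1, hout _ h2⟩
        · rintro ⟨h, h1, h2⟩
          exact ⟨h, hin _ (hw.exhaust _ _ h) h1, hin _ (hw.exhaust _ _ (Sym2.eq_swap ▸ h)) h2⟩
    rw [hspan] at htree
    obtain ⟨i, j, l, hij, hil, hjl, hN⟩ := Finset.card_eq_three.1
      (show backDegree X w m = 3 by omega)
    have hmem : ∀ r ∈ ({i, j, l} : Finset ℕ), r < m ∧ s(w r, w m) ∈ X := by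
      intro r hr
      rw [← hN, Finset.mem_filter, Finset.mem_range] at hr
      exact hr
    obtain ⟨him, hia⟩ := hmem i (by simp)
    obtain ⟨hjm, hjb⟩ := hmem j (by simp)
    obtain ⟨hlm, hlc⟩ := hmem l (by simp)
    have hnbr : ∀ z, s(w m, z) ∈ X → z = w i ∨ z = w j ∨ z = w l := by
      intro z hz
      obtain ⟨r, hr, rfl⟩ := hw.exhaust z _ (Sym2.eq_swap ▸ hz)
      have hrm : r ≠ m := by
        rintro rfl
        exact hX.loopless _ hz
      have : r ∈ ({i, j, l} : Finset ℕ) := by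
        rw [← hN, Finset.mem_filter, Finset.mem_range]
        exact ⟨by omega, Sym2.eq_swap ▸ hz⟩
      simp only [Finset.mem_insert, Finset.mem_singleton] at this
      rcases this with rfl | rfl | rfl <;> simp
    have hinj : ∀ {r s}, r < m + 1 → s < m + 1 → r ≠ s → w r ≠ w s := fun hr hs hrs h =>
      hrs (hw.injOn (Set.mem_Iio.2 hr) (Set.mem_Iio.2 hs) h)
    exact htree.survives_of_three hX hK hnbr (hinj (by omega) (by omega) hij)
      (hinj (by omega) (by omega) hil) (hinj (by omega) (by omega) hjl) (Sym2.eq_swap ▸ hia)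
      (Sym2.eq_swap ▸ hjb) (Sym2.eq_swap ▸ hlc) t
  · obtain ⟨p, q, hpq, hq2, -, h02, h12⟩ := hw.attach 2 le_rfl (by omega)
    obtain ⟨rfl, rfl⟩ : p = 0 ∧ q = 1 := by omega
    obtain ⟨p, q, hpq, hq3, hpqX, hp3, hq3X⟩ := hw.attach 3 (by norm_num) (by omega)
    have hd : ∀ i < 3, w i ≠ w 3 := fun i hi h => by
      have := hw.injOn (Set.mem_Iio.2 (by omega)) (Set.mem_Iio.2 (by omega)) h
      omega
    interval_cases q <;> interval_cases p
    · exact hX.survives_of_diamond hK hc (by omega) hpqX h02 h12 hp3 hq3X (hd 2 (by norm_num)) t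
    · exact hX.survives_of_diamond hK hc (by omega) hpqX hw01 (Sym2.eq_swap ▸ h12) hp3 hq3X
        (hd 1 (by norm_num)) t
    · exact hX.survives_of_diamond hK hc (by omega) hpqX (Sym2.eq_swap ▸ hw01)
        (Sym2.eq_swap ▸ h02) hp3 hq3X (hd 0 (by norm_num)) t

theorem IsReduced.survives (hX : IsReduced X) {x y : V} (hxy : s(x, y) ∈ X) (t : ℕ) :
    Survives arcEdge t (cyclicTriangles X) := by
  by_cases hK : NoK4 X
  · exact hX.survives_of_noK4 hK hxy t
  · simp only [NoK4, not_forall, not_not] at hK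
    obtain ⟨a, b, c, d, hab, hac, had, hbc, hbd, hcd⟩ := hK
    exact hX.survives_of_K4 hab hac had hbc hbd hcd t

theorem Sparse.survives {X : Finset (Sym2 V)} (hS : Sparse X) (hX : ∀ x, s(x, x) ∉ X) (t : ℕ) :
    Survives arcEdge t (cyclicTriangles X) := by
  induction hm : X.card using Nat.strong_induction_on generalizing X with
  | _ m ih =>
    subst hm
    have ih : ∀ Y, Y ⊂ X → Survives arcEdge t (cyclicTriangles Y) := fun Y hY =>
      ih _ (Finset.card_lt_card hY) (hS.mono hY.1) (fun x hx => hX x (hY.1 hx)) rfl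
    rcases X.eq_empty_or_nonempty with rfl | ⟨e, he⟩
    · refine (survives_empty t).mono ?_
      rintro H ⟨x, y, z, -, -, -, h, -⟩
      simp at h
    by_contra hcon
    induction e with
    | _ x y =>
      refine hcon (IsReduced.survives ⟨hX, hS, ?_, ?_, ?_⟩ he t)
      · intro S hcl hne
        by_contra hsub
        refine hcon (survives_of_closed hcl (ih _ ?_) (ih _ ?_))
        · refine Finset.ssubset_iff_subset_ne.2 ⟨Finset.inter_subset_left, fun h => hsub ?_⟩
          exact Finset.inter_eq_left.1 h
        · refine Finset.ssubset_iff_subset_ne.2 ⟨Finset.sdiff_subset, fun h => ?_⟩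
          obtain ⟨f, hf⟩ := hne
          rw [Finset.mem_inter] at hf
          exact (Finset.mem_sdiff.1 (h.symm ▸ hf.1)).2 hf.2
      · intro x y hxy
        by_contra! h
        exact hcon (survives_of_not_in_triangle h (ih _ (Finset.erase_ssubset hxy)))
      · intro u w huw N hN
        by_contra! h
        refine hcon (survives_of_degree_le_two hX huw hN (by omega) (ih _ ?_))
        refine Finset.filter_ssubset.2 ⟨_, huw, ?_⟩
        simp

end ReducedBoards

section Maker

variable {V : Type*} [DecidableEq V] {X : Finset (Sym2 V)}

theorem OMakerWin.of_path {M : Finset (V × V)} {B : Finset (Sym2 V)} {x y z : V} (hxy : x ≠ y)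
    (hyz : y ≠ z) (hxz : x ≠ z) (h₁ : (x, y) ∈ M) (h₂ : (y, z) ∈ M) (hX : s(z, x) ∈ X)
    (hfree : s(z, x) ∉ undirect M ∪ B) : OMakerWin X HasCyclicTriangle 1 M B :=
  .move _ _ z x hX hfree fun _ _ _ => .win _ _
    ⟨x, y, z, hxy, hyz, hxz, by simp [h₁], by simp [h₂], by simp⟩

/-- Maker owns the spoke `h → t` of a wheel with hub `h` and rim `t a b c`. -/
theorem OMakerWin.of_wheel {B : Finset (Sym2 V)} {h t a b c : V}
    (hnd : [h, t, a, b, c].Nodup)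
    (hX : ∀ e ∈ [s(h, a), s(h, b), s(h, c), s(t, a), s(a, b), s(b, c), s(c, t)], e ∈ X ∧ e ∉ B) :
    OMakerWin X HasCyclicTriangle 1 {(h, t)} B := by
  simp only [List.nodup_cons, List.mem_cons, List.not_mem_nil, or_false, not_or,
    List.nodup_nil, not_false_iff, and_true, ← ne_eq] at hnd
  obtain ⟨⟨hht, hha, hhb, hhc⟩, ⟨hta, htb, htc⟩, ⟨hab, hac⟩, hbc⟩ := hnd
  simp only [List.mem_cons, List.not_mem_nil, or_false, forall_eq_or_imp, forall_eq] at hX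
  obtain ⟨⟨xha, bha⟩, ⟨xhb, bhb⟩, ⟨xhc, bhc⟩, ⟨xta, bta⟩, ⟨xab, bab⟩, ⟨xbc, bbc⟩, xct, bct⟩ := hX
  have hone : ∀ {B' : Finset (Sym2 V)} {k : ℕ} {e : Sym2 V}, B'.card = min 1 k → e ∈ B' →
      B' = {e} := by
    intro B' k e hB he
    exact (Finset.eq_of_subset_of_card_le (Finset.singleton_subset_iff.2 he)
      (by rw [hB, Finset.card_singleton]; exact min_le_left _ _)).symm
  refine .move _ _ a h (by rwa [Sym2.eq_swap]) ?_ fun B₁ _ hB₁ => ?_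
  · rw [Sym2.eq_swap]
    simp only [undirect, Finset.image_singleton, Finset.mem_union, Finset.mem_singleton, Sym2.eq_iff]
    grind
  by_cases h₁ : s(t, a) ∈ B₁
  swap
  · refine .of_path (x := a) (y := h) (z := t) hha.symm hht hta.symm (by simp) (by simp) xta ?_
    simp only [undirect, Finset.image_insert, Finset.image_singleton, Finset.mem_union, Finset.mem_insert,
      Finset.mem_singleton, Sym2.eq_iff]
    grind
  rw [hone hB₁ h₁]
  refine .move _ _ h b xhb ?_ fun B₂ _ hB₂ => ?_
  · simp only [undirect, Finset.image_insert, Finset.image_singleton, Finset.mem_union, Finset.mem_insert,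
      Finset.mem_singleton, Sym2.eq_iff]
    grind
  by_cases h₂ : s(a, b) ∈ B₂
  swap
  · rw [Sym2.eq_swap] at xab bab h₂
    refine .of_path (x := a) (y := h) (z := b) hha.symm hhb hab (by simp) (by simp) xab ?_
    simp only [undirect, Finset.image_insert, Finset.image_singleton, Finset.mem_union, Finset.mem_insert,
      Finset.mem_singleton, Sym2.eq_iff]
    grind
  rw [hone hB₂ h₂]
  refine .move _ _ c h (by rwa [Sym2.eq_swap]) ?_ fun B₃ _ hB₃ => ?_
  · rw [Sym2.eq_swap]
    simp only [undirect, Finset.image_insert, Finset.image_singleton, Finset.mem_union, Finset.mem_insert,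
      Finset.mem_singleton, Sym2.eq_iff]
    grind
  by_cases h₃ : s(b, c) ∈ B₃
  · rw [hone hB₃ h₃]
    rw [Sym2.eq_swap] at xct bct
    refine .of_path (x := c) (y := h) (z := t) hhc.symm hht (Ne.symm htc) (by simp) (by simp) xct ?_
    simp only [undirect, Finset.image_insert, Finset.image_singleton, Finset.mem_union, Finset.mem_insert,
      Finset.mem_singleton, Sym2.eq_iff]
    grind
  · refine .of_path (x := c) (y := h) (z := b) hhc.symm hhb (Ne.symm hbc) (by simp) (by simp) xbc ?_
    simp only [undirect, Finset.image_insert, Finset.image_singleton, Finset.mem_union, Finset.mem_insert,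
      Finset.mem_singleton, Sym2.eq_iff]
    grind

/-- Two wheels with four spokes sharing their hub `0` and the spoke from `0` to `1`. -/
def twoWheels : Finset (Sym2 (Fin 8)) :=
  {s(0, 1), s(0, 2), s(0, 3), s(0, 4), s(0, 5), s(0, 6), s(0, 7), s(1, 4), s(1, 5), s(1, 6),
    s(1, 7), s(2, 6), s(2, 7), s(3, 4), s(3, 5)}

theorem card_twoWheels : twoWheels.card = 15 := by decide

theorem oMakerWin_of_twoWheels {f : Fin 8 → V} (hf : Function.Injective f)
    (hX : twoWheels.image (Sym2.map f) ⊆ X) : OMakerWin X HasCyclicTriangle 1 ∅ ∅ := by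
  have hX' : ∀ a b, s(a, b) ∈ twoWheels → s(f a, f b) ∈ X := fun a b h =>
    hX (Finset.mem_image_of_mem (Sym2.map f) h)
  refine .move _ _ (f 0) (f 1) (hX' _ _ (by decide)) (by simp [undirect]) fun B _ hB => ?_
  rw [Finset.empty_union, insert_empty_eq]
  have hB1 : B.card ≤ 1 := hB.le.trans (min_le_left _ _)
  have key : ∀ a b c, [0, 1, a, b, c].Nodup →
      (∀ e ∈ [s(0, a), s(0, b), s(0, c), s(1, a), s(a, b), s(b, c), s(c, 1)], e ∈ twoWheels) →
      (∀ e ∈ [s(0, a), s(0, b), s(0, c), s(1, a), s(a, b), s(b, c), s(c, 1)],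
        e.map f ∉ B) → OMakerWin X HasCyclicTriangle 1 {(f 0, f 1)} B := by
    intro a b c hnd h h'
    refine .of_wheel (a := f a) (b := f b) (c := f c) (hnd.map hf) fun e he => ?_
    change e ∈ List.map (Sym2.map f)
      [s(0, a), s(0, b), s(0, c), s(1, a), s(a, b), s(b, c), s(c, 1)] at he
    obtain ⟨e', he', rfl⟩ := List.mem_map.1 he
    exact ⟨hX (Finset.mem_image_of_mem _ (h _ he')), h' _ he'⟩
  by_contra hcon
  have h₁ := fun h => hcon (key 4 3 5 (by decide) (by decide) h)
  have h₂ := fun h => hcon (key 6 2 7 (by decide) (by decide) h)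
  obtain ⟨e, he, heB⟩ := not_forall₂.1 h₁
  obtain ⟨e', he', heB'⟩ := not_forall₂.1 h₂
  have := Sym2.map.injective hf (Finset.card_le_one.1 hB1 _ (not_not.1 heB) _ (not_not.1 heB'))
  subst this
  clear heB heB'
  revert e
  decide

/-- The two wheels are balanced. -/
theorem card_twoWheels_filter_le (J : Finset (Fin 8)) :
    8 * (twoWheels.filter fun e => e ∈ J.sym2).card ≤ 15 * J.card := by
  revert J
  decide +kernel

end Maker

section RandomSubset

variable {α ι : Type*} [DecidableEq α] {E : Finset α} {p : ℝ} {P Q : Finset α → Prop}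

theorem edgeProb_eq_sum_filter [DecidablePred P] :
    edgeProb E p P = ∑ A ∈ E.powerset with P A, p ^ A.card * (1 - p) ^ (E.card - A.card) := by
  rw [Finset.sum_filter, edgeProb]
  exact Finset.sum_congr rfl fun A _ => by congr

theorem weight_nonneg (h0 : 0 ≤ p) (h1 : p ≤ 1) (a b : ℕ) : 0 ≤ p ^ a * (1 - p) ^ b :=
  mul_nonneg (pow_nonneg h0 _) (pow_nonneg (sub_nonneg.2 h1) _)

theorem edgeProb_mono (h0 : 0 ≤ p) (h1 : p ≤ 1) (h : ∀ A ⊆ E, P A → Q A) :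
    edgeProb E p P ≤ edgeProb E p Q := by
  refine Finset.sum_le_sum fun A hA => ?_
  have := weight_nonneg h0 h1 A.card (E.card - A.card)
  split_ifs with hP hQ
  · exact le_rfl
  · exact absurd (h A (Finset.mem_powerset.1 hA) hP) hQ
  · exact this
  · exact le_rfl

theorem edgeProb_add_edgeProb_not : edgeProb E p P + edgeProb E p (fun A => ¬ P A) = 1 := by
  classical
  have h := Finset.sum_pow_mul_eq_add_pow p (1 - p) E
  rw [add_sub_cancel, one_pow] at h
  rw [← h, edgeProb, edgeProb, ← Finset.sum_add_distrib]
  refine Finset.sum_congr rfl fun A _ => ?_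
  by_cases hP : P A <;> simp [hP]

theorem edgeProb_nonneg (h0 : 0 ≤ p) (h1 : p ≤ 1) : 0 ≤ edgeProb E p P :=
  Finset.sum_nonneg fun A _ => by
    split_ifs
    exacts [weight_nonneg h0 h1 _ _, le_rfl]

theorem edgeProb_le_one (h0 : 0 ≤ p) (h1 : p ≤ 1) : edgeProb E p P ≤ 1 := by
  rw [← edgeProb_add_edgeProb_not (E := E) (p := p) (P := P)]
  exact le_add_of_nonneg_right (edgeProb_nonneg h0 h1)

theorem edgeProb_superset {D : Finset α} (hD : D ⊆ E) :
    edgeProb E p (fun A => D ⊆ A) = p ^ D.card := by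
  have h := Finset.sum_pow_mul_eq_add_pow p (1 - p) (E \ D)
  rw [add_sub_cancel, one_pow] at h
  have h' : p ^ D.card = p ^ D.card *
      ∑ A ∈ (E \ D).powerset, p ^ A.card * (1 - p) ^ ((E \ D).card - A.card) := by
    rw [h, mul_one]
  rw [edgeProb_eq_sum_filter, h', Finset.mul_sum]
  refine Finset.sum_nbij' (· \ D) (· ∪ D) ?_ ?_ ?_ ?_ ?_
  · intro A hA
    rw [Finset.mem_filter, Finset.mem_powerset] at hA
    exact Finset.mem_powerset.2 (Finset.sdiff_subset_sdiff hA.1 le_rfl)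
  · intro A hA
    rw [Finset.mem_powerset] at hA
    rw [Finset.mem_filter, Finset.mem_powerset]
    exact ⟨Finset.union_subset (hA.trans Finset.sdiff_subset) hD, Finset.subset_union_right⟩
  · intro A hA
    exact Finset.sdiff_union_of_subset (Finset.mem_filter.1 hA).2
  · intro A hA
    rw [Finset.mem_powerset] at hA
    rw [Finset.union_sdiff_right, Finset.sdiff_eq_self_iff_disjoint]
    exact (Finset.subset_sdiff.1 hA).2
  · intro A hA
    rw [Finset.mem_filter, Finset.mem_powerset] at hA
    have h1 := Finset.card_sdiff_add_card_eq_card hA.2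
    have h2 := Finset.card_sdiff_add_card_eq_card hD
    have h3 := Finset.card_le_card hA.1
    rw [← mul_assoc, ← pow_add]
    congr 2 <;> omega

theorem edgeProb_exists_superset_le (h0 : 0 ≤ p) (h1 : p ≤ 1) {F : Finset ι} {D : ι → Finset α}
    (hD : ∀ i ∈ F, D i ⊆ E) :
    edgeProb E p (fun A => ∃ i ∈ F, D i ⊆ A) ≤ ∑ i ∈ F, p ^ (D i).card := by
  classical
  rw [← Finset.sum_congr rfl fun i hi => edgeProb_superset (p := p) (hD i hi)]
  simp only [edgeProb]
  rw [Finset.sum_comm]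
  refine Finset.sum_le_sum fun A _ => ?_
  have hw := weight_nonneg h0 h1 A.card (E.card - A.card)
  split_ifs with h
  · obtain ⟨i, hi, hiA⟩ := h
    refine le_trans (le_of_eq ?_) (Finset.single_le_sum (fun j _ => ?_) hi)
    · exact (if_pos hiA).symm
    split_ifs <;> [exact hw; exact le_rfl]
  · refine Finset.sum_nonneg fun j _ => ?_
    split_ifs <;> [exact hw; exact le_rfl]

/-- The second moment method. -/
theorem sq_sum_le_edgeProb_mul (h0 : 0 ≤ p) (h1 : p ≤ 1) {F : Finset ι} {D : ι → Finset α}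
    (hD : ∀ i ∈ F, D i ⊆ E) :
    (∑ i ∈ F, p ^ (D i).card) ^ 2 ≤ edgeProb E p (fun A => ∃ i ∈ F, D i ⊆ A) *
      ∑ i ∈ F, ∑ j ∈ F, p ^ (D i ∪ D j).card := by
  classical
  set W : Finset α → ℝ := fun A => p ^ A.card * (1 - p) ^ (E.card - A.card) with hW
  set N : Finset α → ℝ := fun A => ∑ i ∈ F, if D i ⊆ A then 1 else 0 with hN
  have hfirst : ∑ i ∈ F, p ^ (D i).card = ∑ A ∈ E.powerset, W A * N A := by
    rw [← Finset.sum_congr rfl fun i hi => edgeProb_superset (p := p) (hD i hi)]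
    simp only [edgeProb, hN, Finset.mul_sum, mul_ite, mul_one, mul_zero]
    rw [Finset.sum_comm]
    congr!
  have hsecond : ∑ i ∈ F, ∑ j ∈ F, p ^ (D i ∪ D j).card = ∑ A ∈ E.powerset, W A * N A ^ 2 := by
    have : ∀ i ∈ F, ∀ j ∈ F, p ^ (D i ∪ D j).card =
        ∑ A ∈ E.powerset, W A * ((if D i ⊆ A then 1 else 0) * if D j ⊆ A then 1 else 0) := by
      intro i hi j hj
      rw [← edgeProb_superset (Finset.union_subset (hD i hi) (hD j hj)), edgeProb]
      refine Finset.sum_congr rfl fun A _ => ?_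
      by_cases hi : D i ⊆ A <;> by_cases hj : D j ⊆ A <;>
        simp [Finset.union_subset_iff, hi, hj, hW]
    rw [Finset.sum_congr rfl fun i hi => Finset.sum_congr rfl fun j hj => this i hi j hj]
    simp only [hN, sq, Finset.sum_mul_sum]
    rw [Finset.sum_congr rfl fun i _ => Finset.sum_comm, Finset.sum_comm]
    exact Finset.sum_congr rfl fun A _ => by simp only [Finset.mul_sum]
  rw [hfirst, hsecond]
  have hWnn : ∀ A, 0 ≤ W A := fun A => weight_nonneg h0 h1 _ _
  refine Finset.sum_sq_le_sum_mul_sum_of_sq_le_mul _ (fun A _ => ?_)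
    (fun A _ => mul_nonneg (hWnn A) (sq_nonneg _)) fun A _ => le_of_eq ?_
  · split_ifs
    exacts [hWnn A, le_rfl]
  · split_ifs with h
    · change _ = W A * _
      ring
    · have : N A = 0 := Finset.sum_eq_zero fun i hi => if_neg fun hA => h ⟨i, hi, hA⟩
      simp [this]

end RandomSubset

section RandomGraph

variable {n m : ℕ} {r : ℝ}

theorem pow_pow_le_of_le {a b c d : ℕ} (h0 : 0 ≤ r) (h1 : r ≤ 1) (h : c * d ≤ a * b) :
    (r ^ a) ^ b ≤ (r ^ c) ^ d := by
  rw [← pow_mul, ← pow_mul]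
  exact pow_le_pow_of_le_one h0 h1 h

set_option exponentiation.threshold 400 in
theorem edgeProb_not_sparse_le (h0 : 0 ≤ r) (h1 : r ≤ 1) :
    edgeProb (completeEdges n) (r ^ 8) (fun A => ¬ Sparse A) ≤
      2 ^ 325 * (Real.exp (n * r ^ 15) - 1) := by
  classical
  set F : Finset (Finset (Fin n)) := {S | S.Nonempty ∧ S.card ≤ 25} with hF
  set K : Finset (Fin n) → Finset (Finset (Sym2 (Fin n))) := fun S =>
    (completeEdges n ∩ S.sym2).powersetCard ((15 * S.card + 7) / 8) with hK
  have hp0 : 0 ≤ r ^ 8 := pow_nonneg h0 8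
  have hp1 : r ^ 8 ≤ 1 := pow_le_one₀ h0 h1
  calc
    _ ≤ edgeProb (completeEdges n) (r ^ 8) (fun A => ∃ x ∈ F.sigma K, x.2 ⊆ A) := by
      refine edgeProb_mono hp0 hp1 fun A hA hS => ?_
      simp only [Sparse, not_forall, not_lt] at hS
      obtain ⟨S, hne, hcard, hS⟩ := hS
      obtain ⟨D, hDA, hD⟩ := Finset.exists_subset_card_eq
        (show (15 * S.card + 7) / 8 ≤ (A ∩ S.sym2).card by omega)
      refine ⟨⟨S, D⟩, Finset.mem_sigma.2 ⟨by simp [hF, hne, hcard], ?_⟩,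
        hDA.trans Finset.inter_subset_left⟩
      exact Finset.mem_powersetCard.2 ⟨hDA.trans (Finset.inter_subset_inter_right hA), hD⟩
    _ ≤ ∑ x ∈ F.sigma K, (r ^ 8) ^ x.2.card := by
      refine edgeProb_exists_superset_le hp0 hp1 fun x hx => ?_
      exact (Finset.mem_powersetCard.1 (Finset.mem_sigma.1 hx).2).1.trans Finset.inter_subset_left
    _ = ∑ S ∈ F, ∑ D ∈ K S, (r ^ 8) ^ D.card := Finset.sum_sigma _ _ _
    _ ≤ ∑ S ∈ F, 2 ^ 325 * (r ^ 15) ^ S.card := by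
      refine Finset.sum_le_sum fun S hS => ?_
      have hS : S.card ≤ 25 := (Finset.mem_filter.1 hS).2.2
      have hcard : (K S).card ≤ 2 ^ 325 := by
        rw [Finset.card_powersetCard]
        refine (Nat.choose_le_two_pow _ _).trans (Nat.pow_le_pow_right two_pos ?_)
        refine (Finset.card_le_card Finset.inter_subset_right).trans ?_
        rw [Finset.card_sym2]
        exact Nat.choose_le_choose 2 (Nat.succ_le_succ hS)
      calc
        _ ≤ ∑ D ∈ K S, (r ^ 15) ^ S.card := by
          refine Finset.sum_le_sum fun D hD => pow_pow_le_of_le h0 h1 ?_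
          rw [(Finset.mem_powersetCard.1 hD).2]
          omega
        _ = (K S).card * (r ^ 15) ^ S.card := by rw [Finset.sum_const, nsmul_eq_mul]
        _ ≤ _ := by
          refine mul_le_mul_of_nonneg_right ?_ (by positivity)
          exact_mod_cast hcard
    _ = 2 ^ 325 * (∑ S ∈ F, (r ^ 15) ^ S.card) := by rw [Finset.mul_sum]
    _ ≤ _ := by
      refine mul_le_mul_of_nonneg_left ?_ (by positivity)
      rw [le_sub_iff_add_le]
      have hnot : ∅ ∉ F := by simp [hF]
      calc
        _ = ∑ S ∈ insert ∅ F, (r ^ 15) ^ S.card := by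
          rw [Finset.sum_insert hnot, Finset.card_empty, pow_zero, add_comm]
        _ ≤ ∑ S ∈ (Finset.univ : Finset (Fin n)).powerset,
            (r ^ 15) ^ S.card * 1 ^ ((Finset.univ : Finset (Fin n)).card - S.card) := by
          simp only [one_pow, mul_one]
          exact Finset.sum_le_sum_of_subset_of_nonneg (fun S _ => by simp)
            fun S _ _ => by positivity
        _ = (r ^ 15 + 1) ^ n := by
          rw [Finset.sum_pow_mul_eq_add_pow, Finset.card_univ, Fintype.card_fin]
        _ ≤ Real.exp (r ^ 15) ^ n :=
          pow_le_pow_left₀ (by positivity) (Real.add_one_le_exp _) n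
        _ = _ := (Real.exp_nat_mul _ n).symm

/-- The embedding of `Fin 8` into `Fin n` whose `i`-th value is `f i` in the `i`-th block of length
`m`. -/
def blockEmb (h : 8 * m ≤ n) (f : Fin 8 → Fin m) (i : Fin 8) : Fin n :=
  Fin.castLE h (finProdFinEquiv (i, f i))

theorem blockEmb_eq_iff {h : 8 * m ≤ n} {f g : Fin 8 → Fin m} {i j : Fin 8} :
    blockEmb h f i = blockEmb h g j ↔ i = j ∧ f i = g j := by
  rw [blockEmb, blockEmb, (Fin.castLE_injective h).eq_iff, finProdFinEquiv.injective.eq_iff,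
    Prod.mk.injEq]

theorem blockEmb_injective (h : 8 * m ≤ n) (f : Fin 8 → Fin m) :
    Function.Injective (blockEmb h f) := fun _ _ hij => (blockEmb_eq_iff.1 hij).1

/-- The copy of `twoWheels` placed by `blockEmb`. -/
def wheelCopy (h : 8 * m ≤ n) (f : Fin 8 → Fin m) : Finset (Sym2 (Fin n)) :=
  twoWheels.image (Sym2.map (blockEmb h f))

theorem wheelCopy_subset (h : 8 * m ≤ n) (f : Fin 8 → Fin m) :
    wheelCopy h f ⊆ completeEdges n := by
  intro e he
  obtain ⟨a, ha, rfl⟩ := Finset.mem_image.1 he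
  refine Finset.mem_filter.2 ⟨Finset.mem_univ _, ?_⟩
  rw [Sym2.isDiag_map (blockEmb_injective h f)]
  clear * - ha
  revert a
  decide

theorem card_wheelCopy (h : 8 * m ≤ n) (f : Fin 8 → Fin m) : (wheelCopy h f).card = 15 := by
  rw [wheelCopy, Finset.card_image_of_injective _ (Sym2.map.injective (blockEmb_injective h f)),
    card_twoWheels]

theorem card_wheelCopy_inter_le (h : 8 * m ≤ n) (f g : Fin 8 → Fin m) :
    8 * (wheelCopy h f ∩ wheelCopy h g).card ≤
      15 * (Finset.univ.filter fun i => f i = g i).card := by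
  refine le_trans (Nat.mul_le_mul_left 8 ?_) (card_twoWheels_filter_le _)
  refine le_trans (Finset.card_le_card (fun e he => ?_))
    (Finset.card_image_le (f := Sym2.map (blockEmb h f)))
  obtain ⟨h₁, h₂⟩ := Finset.mem_inter.1 he
  obtain ⟨a, ha, rfl⟩ := Finset.mem_image.1 h₁
  obtain ⟨b, -, hab⟩ := Finset.mem_image.1 h₂
  refine Finset.mem_image_of_mem _ (Finset.mem_filter.2 ⟨ha, ?_⟩)
  induction a with
  | _ x y =>
    induction b with
    | _ z w =>
      rw [Sym2.map_mk, Sym2.map_mk, Sym2.eq_iff] at hab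
      simp only [blockEmb_eq_iff] at hab
      rw [Finset.mk_mem_sym2_iff, Finset.mem_filter, Finset.mem_filter]
      grind

theorem pow_le_edgeProb_oMakerWin_mul (h : 8 * m ≤ n) (h0 : 0 ≤ r) (h1 : r ≤ 1) :
    (m * r ^ 15) ^ 8 ≤ edgeProb (completeEdges n) (r ^ 8)
      (fun A => OMakerWin A HasCyclicTriangle 1 ∅ ∅) * (1 + m * r ^ 15) ^ 8 := by
  have hp0 : 0 ≤ r ^ 8 := pow_nonneg h0 8
  have hp1 : r ^ 8 ≤ 1 := pow_le_one₀ h0 h1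
  rcases h0.eq_or_lt with rfl | h0
  · simpa using edgeProb_nonneg hp0 hp1
  rcases m.eq_zero_or_pos with rfl | hm
  · simpa using edgeProb_nonneg hp0 hp1
  have hm : (0 : ℝ) < m := by exact_mod_cast hm
  set P := edgeProb (completeEdges n) (r ^ 8) (fun A => OMakerWin A HasCyclicTriangle 1 ∅ ∅)
  have hmom := sq_sum_le_edgeProb_mul hp0 hp1 (F := (Finset.univ : Finset (Fin 8 → Fin m)))
    (D := wheelCopy h) fun f _ => wheelCopy_subset h f
  have hP : edgeProb (completeEdges n) (r ^ 8)
      (fun A => ∃ f ∈ (Finset.univ : Finset (Fin 8 → Fin m)), wheelCopy h f ⊆ A) ≤ P :=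
    edgeProb_mono hp0 hp1 fun A _ ⟨f, _, hf⟩ => oMakerWin_of_twoWheels (blockEmb_injective h f) hf
  have hP0 : 0 ≤ P := edgeProb_nonneg hp0 hp1
  simp only [card_wheelCopy, Finset.sum_const, Finset.card_univ, Fintype.card_fun, Fintype.card_fin,
    nsmul_eq_mul, Nat.cast_pow] at hmom
  have hpair : ∀ f g : Fin 8 → Fin m, (r ^ 15) ^ 8 * (r ^ 8) ^ (wheelCopy h f ∪ wheelCopy h g).card ≤
      (r ^ 8) ^ 30 * ∏ i, if f i = g i then 1 else r ^ 15 := by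
    intro f g
    rw [Finset.prod_ite, Finset.prod_const, Finset.prod_const, one_pow, one_mul]
    have h2 := card_wheelCopy_inter_le h f g
    have h3 := Finset.card_union_add_card_inter (wheelCopy h f) (wheelCopy h g)
    rw [card_wheelCopy, card_wheelCopy] at h3
    have h4 := Finset.card_filter_add_card_filter_not (s := (Finset.univ : Finset (Fin 8)))
      (fun i => f i = g i)
    rw [Finset.card_univ, Fintype.card_fin] at h4
    simp only [← pow_mul, ← pow_add]
    refine pow_le_pow_of_le_one h0.le h1 ?_
    omega
  have hsum : (r ^ 15) ^ 8 * ∑ f : Fin 8 → Fin m, ∑ g : Fin 8 → Fin m,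
      (r ^ 8) ^ (wheelCopy h f ∪ wheelCopy h g).card ≤
      m ^ 8 * ((r ^ 8) ^ 30 * (1 + m * r ^ 15) ^ 8) := by
    simp only [Finset.mul_sum]
    calc
      _ ≤ ∑ f : Fin 8 → Fin m, ∑ g : Fin 8 → Fin m,
          (r ^ 8) ^ 30 * ∏ i, if f i = g i then 1 else r ^ 15 :=
        Finset.sum_le_sum fun f _ => Finset.sum_le_sum fun g _ => hpair f g
      _ ≤ ∑ f : Fin 8 → Fin m, (r ^ 8) ^ 30 * (1 + m * r ^ 15) ^ 8 := by
        refine Finset.sum_le_sum fun f _ => ?_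
        rw [← Finset.mul_sum]
        refine mul_le_mul_of_nonneg_left ?_ (by positivity)
        rw [← Fintype.prod_sum fun i v => if f i = v then (1 : ℝ) else r ^ 15]
        have hi : ∀ i, ∑ v, (if f i = v then (1 : ℝ) else r ^ 15) ≤ 1 + m * r ^ 15 := fun i => by
          calc
            _ ≤ ∑ v, ((if f i = v then (1 : ℝ) else 0) + r ^ 15) := by
              refine Finset.sum_le_sum fun v _ => ?_
              split_ifs
              · exact le_add_of_nonneg_right (by positivity)
              · rw [zero_add]
            _ = _ := by simp [Finset.sum_add_distrib]
        refine (Finset.prod_le_prod (fun i _ => Finset.sum_nonneg fun v _ => ?_)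
          fun i _ => hi i).trans_eq (by simp)
        split_ifs <;> positivity
      _ = _ := by simp
  have hfin : (m ^ 8 * (r ^ 8) ^ 30) * (m * r ^ 15) ^ 8 ≤
      (m ^ 8 * (r ^ 8) ^ 30) * (P * (1 + m * r ^ 15) ^ 8) := by
    calc
      _ = (r ^ 15) ^ 8 * (m ^ 8 * (r ^ 8) ^ 15) ^ 2 := by ring
      _ ≤ (r ^ 15) ^ 8 * (P * ∑ f : Fin 8 → Fin m, ∑ g : Fin 8 → Fin m,
          (r ^ 8) ^ (wheelCopy h f ∪ wheelCopy h g).card) := by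
        refine mul_le_mul_of_nonneg_left (hmom.trans ?_) (by positivity)
        exact mul_le_mul_of_nonneg_right hP (by positivity)
      _ = P * ((r ^ 15) ^ 8 * ∑ f : Fin 8 → Fin m, ∑ g : Fin 8 → Fin m,
          (r ^ 8) ^ (wheelCopy h f ∪ wheelCopy h g).card) := by ring
      _ ≤ P * (m ^ 8 * ((r ^ 8) ^ 30 * (1 + m * r ^ 15) ^ 8)) :=
        mul_le_mul_of_nonneg_left hsum hP0
      _ = _ := by ring
  exact le_of_mul_le_mul_left hfin (by positivity)

end RandomGraph

section Threshold

open Filter Topology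

theorem mul_rpow_pow_fifteen {p : ℝ} (hp : 0 ≤ p) (n : ℕ) :
    n * (p ^ (1 / 8 : ℝ)) ^ 15 = (p * (n : ℝ) ^ (8 / 15 : ℝ)) ^ (15 / 8 : ℝ) := by
  have hn : (0 : ℝ) ≤ n := n.cast_nonneg
  rw [Real.mul_rpow hp (Real.rpow_nonneg hn _), ← Real.rpow_mul hn, ← Real.rpow_natCast,
    ← Real.rpow_mul hp, mul_comm]
  norm_num

theorem rpow_one_div_eight_pow {p : ℝ} (hp : 0 ≤ p) : (p ^ (1 / 8 : ℝ)) ^ 8 = p := by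
  rw [← Real.rpow_natCast, ← Real.rpow_mul hp]
  norm_num

theorem tendsto_edgeProb_oMakerWin
    {p : ℕ → ℝ} (hp0 : ∀ n, 0 ≤ p n) (hp1 : ∀ n, p n ≤ 1)
    (h : Tendsto (fun n : ℕ => p n * (n : ℝ) ^ (8 / 15 : ℝ)) atTop atTop) :
    Tendsto (fun n : ℕ => edgeProb (completeEdges n) (p n)
      (fun A => OMakerWin A HasCyclicTriangle 1 ∅ ∅)) atTop (𝓝 1) := by
  set y : ℕ → ℝ := fun n => (n / 8 : ℕ) * (p n ^ (1 / 8 : ℝ)) ^ 15 with hy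
  have hr0 : ∀ n, 0 ≤ p n ^ (1 / 8 : ℝ) := fun n => Real.rpow_nonneg (hp0 n) _
  have hr1 : ∀ n, p n ^ (1 / 8 : ℝ) ≤ 1 := fun n => Real.rpow_le_one (hp0 n) (hp1 n) (by norm_num)
  have hy0 : ∀ n, 0 ≤ y n := fun n => mul_nonneg (Nat.cast_nonneg _) (pow_nonneg (hr0 n) _)
  have hytop : Tendsto y atTop atTop := by
    have h' : Tendsto (fun n : ℕ => (p n * (n : ℝ) ^ (8 / 15 : ℝ)) ^ (15 / 8 : ℝ) / 16) atTop atTop :=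
      ((tendsto_rpow_atTop (by norm_num)).comp h).atTop_div_const (by norm_num)
    refine tendsto_atTop_mono' _ ?_ h'
    filter_upwards [eventually_ge_atTop 8] with n hn
    rw [← mul_rpow_pow_fifteen (hp0 n), mul_div_right_comm]
    refine mul_le_mul_of_nonneg_right ?_ (pow_nonneg (hr0 n) _)
    rw [div_le_iff₀ (by norm_num)]
    exact_mod_cast (by omega : n ≤ n / 8 * 16)
  have hlim : Tendsto (fun n => (1 - (1 + y n)⁻¹) ^ 8) atTop (𝓝 1) := by
    have := ((tendsto_const_nhds (x := (1 : ℝ))).sub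
      (tendsto_inv_atTop_zero.comp (tendsto_atTop_add_const_left _ (1 : ℝ) hytop))).pow 8
    simpa using this
  refine tendsto_of_tendsto_of_tendsto_of_le_of_le hlim tendsto_const_nhds (fun n => ?_)
    fun n => edgeProb_le_one (hp0 n) (hp1 n)
  have hpos : 0 < 1 + y n := by linarith [hy0 n]
  have key := pow_le_edgeProb_oMakerWin_mul (Nat.mul_div_le n 8) (hr0 n) (hr1 n)
  rw [rpow_one_div_eight_pow (hp0 n)] at key
  have hrw : 1 - (1 + y n)⁻¹ = y n / (1 + y n) := by
    field_simp
    ring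
  change (1 - (1 + y n)⁻¹) ^ 8 ≤ _
  rw [hrw, div_pow, div_le_iff₀ (by positivity)]
  exact key

set_option exponentiation.threshold 400 in
theorem tendsto_edgeProb_oBreakerBlock
    {p : ℕ → ℝ} (hp0 : ∀ n, 0 ≤ p n) (hp1 : ∀ n, p n ≤ 1)
    (h : Tendsto (fun n : ℕ => p n * (n : ℝ) ^ (8 / 15 : ℝ)) atTop (𝓝 0)) :
    Tendsto (fun n : ℕ => edgeProb (completeEdges n) (p n)
      (fun A => OBreakerBlock A HasCyclicTriangle 1 ∅ ∅)) atTop (𝓝 1) := by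
  have hr0 : ∀ n, 0 ≤ p n ^ (1 / 8 : ℝ) := fun n => Real.rpow_nonneg (hp0 n) _
  have hr1 : ∀ n, p n ^ (1 / 8 : ℝ) ≤ 1 := fun n => Real.rpow_le_one (hp0 n) (hp1 n) (by norm_num)
  have hz : Tendsto (fun n : ℕ => (n : ℝ) * (p n ^ (1 / 8 : ℝ)) ^ 15) atTop (𝓝 0) := by
    simp only [mul_rpow_pow_fifteen (hp0 _)]
    have := h.rpow_const (p := 15 / 8) (.inr (by norm_num))
    rwa [Real.zero_rpow (by norm_num)] at this
  have hlim : Tendsto (fun n : ℕ => 1 - (2 : ℝ) ^ 325 *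
      (Real.exp (n * (p n ^ (1 / 8 : ℝ)) ^ 15) - 1)) atTop (𝓝 1) := by
    have := (((Real.continuous_exp.tendsto 0).comp hz).sub_const 1).const_mul ((2 : ℝ) ^ 325)
    rw [Real.exp_zero, sub_self, mul_zero] at this
    simpa using this.const_sub 1
  refine tendsto_of_tendsto_of_tendsto_of_le_of_le hlim tendsto_const_nhds (fun n => ?_)
    fun n => edgeProb_le_one (hp0 n) (hp1 n)
  have key := edgeProb_not_sparse_le (n := n) (hr0 n) (hr1 n)
  rw [rpow_one_div_eight_pow (hp0 n)] at key
  have hsum := edgeProb_add_edgeProb_not (E := completeEdges n) (p := p n) (P := Sparse)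
  refine le_trans ?_ (edgeProb_mono (P := Sparse) (hp0 n) (hp1 n) fun A hA hS => ?_)
  · change 1 - _ ≤ _
    linarith
  · refine oBreakerBlock_of_survives_cyclicTriangles (hS.survives fun x hx => ?_)
    simpa [completeEdges] using hA hx

end Threshold

/-- `n^{-8/15}` is the threshold probability for the unbiased
`T_C`-tournament game (cyclic triangle) on `G_{n,p}`. -/
theorem cyclic_triangle_threshold_probability
    (p : ℕ → ℝ) (hp0 : ∀ n, 0 ≤ p n) (hp1 : ∀ n, p n ≤ 1) :
    (Filter.Tendsto (fun n : ℕ => p n * (n : ℝ) ^ (8 / 15 : ℝ))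
        Filter.atTop Filter.atTop →
      Filter.Tendsto (fun n : ℕ => edgeProb (completeEdges n) (p n)
          (fun A => OMakerWin A HasCyclicTriangle 1 ∅ ∅)) Filter.atTop (nhds 1)) ∧
    (Filter.Tendsto (fun n : ℕ => p n * (n : ℝ) ^ (8 / 15 : ℝ))
        Filter.atTop (nhds 0) →
      Filter.Tendsto (fun n : ℕ => edgeProb (completeEdges n) (p n)
          (fun A => OBreakerBlock A HasCyclicTriangle 1 ∅ ∅)) Filter.atTop (nhds 1)) :=
  ⟨tendsto_edgeProb_oMakerWin hp0 hp1, tendsto_edgeProb_oBreakerBlock hp0 hp1⟩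

end TournamentGame
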